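/- arXiv:1710.07762 — 3 statements merged into one kernel-verified Lean document; each statement's English description precedes it below -/
import Mathlib

section
/- For the function f^N with f̂^N(ξ) = (δ/√N) Σ_{j=N}^{2N}[χ_j^+(ξ) + χ_j^−(ξ)] and the second Picard iterate A₂(f^N)(t) = ∫₀ᵗ e^{(t−τ)Δ} Σᵢ(∂ᵢ e^{τΔ}f^N)² dτ, at time t_N = 2^{−N} one has ‖Δ̇_{−4}[A₂(f^N)](t_N)‖_{L^∞} ≥ c δ² for all sufficiently large N, where c > 0 is independent of N and δ. -/
open MeasureTheory RealInnerProductSpace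

noncomputable section

/-- Fourier transform of the initial data `f^N`:
`f̂^N(ξ) = (δ/√N) Σ_{j=N}^{2N} [χ(ξ − 2^j e⃗) + χ(ξ + 2^j e⃗)]`. -/
def fNhat (d : ℕ) (χ : EuclideanSpace ℝ (Fin d) → ℝ) (e : EuclideanSpace ℝ (Fin d))
    (δ : ℝ) (N : ℕ) (ξ : EuclideanSpace ℝ (Fin d)) : ℝ :=
  (δ / Real.sqrt N) *
    ∑ j ∈ Finset.Icc N (2*N), (χ (ξ - (2:ℝ)^j • e) + χ (ξ + (2:ℝ)^j • e))

/-- Fourier transform of the second Picard iterate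
`A₂(f^N)(t) = ∫₀ᵗ e^{(t−τ)Δ} Σᵢ (∂ᵢ e^{τΔ} f^N)² dτ`, computed via the Duhamel
formula on the frequency side. -/
def A2hat (d : ℕ) (χ : EuclideanSpace ℝ (Fin d) → ℝ) (e : EuclideanSpace ℝ (Fin d))
    (δ : ℝ) (N : ℕ) (t : ℝ) (ξ : EuclideanSpace ℝ (Fin d)) : ℝ :=
  ∫ τ in (0:ℝ)..t, Real.exp (-(t-τ) * ‖ξ‖^2) *
    ∫ η, (-(⟪η, ξ - η⟫)) * fNhat d χ e δ N (ξ - η) * fNhat d χ e δ N η *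
      Real.exp (-τ * (‖η‖^2 + ‖ξ - η‖^2))

section helpers

variable {d : ℕ} {χ : EuclideanSpace ℝ (Fin d) → ℝ} {e : EuclideanSpace ℝ (Fin d)}

lemma aux_cont_fNhat (hχ : Continuous χ) (δ : ℝ) (N : ℕ) : Continuous (fNhat d χ e δ N) := by
  unfold fNhat
  fun_prop

lemma aux_fNhat_nonneg (hχ : ∀ ξ, χ ξ ∈ Set.Icc (0:ℝ) 1) {δ : ℝ} (hδ : 0 < δ) (N : ℕ)
    (ξ : EuclideanSpace ℝ (Fin d)) : 0 ≤ fNhat d χ e δ N ξ := by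
  unfold fNhat
  refine mul_nonneg (by positivity) (Finset.sum_nonneg fun j _ => ?_)
  exact add_nonneg (hχ _).1 (hχ _).1

lemma aux_chi_zero (hs : Function.support χ ⊆ Metric.closedBall 0 (1/2))
    (ξ : EuclideanSpace ℝ (Fin d)) (h : 1/2 < ‖ξ‖) : χ ξ = 0 := by
  by_contra h0
  have := hs h0
  simp at this
  norm_num at h
  linarith

lemma aux_R (he : 1 ≤ ‖e‖) {N j : ℕ} (hN : 1 ≤ N) (hj : N ≤ j) : 2 ≤ ‖(2:ℝ)^j • e‖ := by
  rw [norm_smul, norm_pow, Real.norm_ofNat]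
  have : (2:ℝ)^1 ≤ 2^j := pow_le_pow_right₀ (by norm_num) (by omega)
  nlinarith

lemma aux_fNhat_small (hs : Function.support χ ⊆ Metric.closedBall 0 (1/2)) (he : 1 ≤ ‖e‖)
    (δ : ℝ) {N : ℕ} (hN : 1 ≤ N) (η : EuclideanSpace ℝ (Fin d)) (h : ‖η‖ < 1/6) :
    fNhat d χ e δ N η = 0 := by
  unfold fNhat
  rw [Finset.sum_eq_zero, mul_zero]
  intro j hj
  have hR := aux_R he hN (Finset.mem_Icc.1 hj).1
  rw [aux_chi_zero hs, aux_chi_zero hs, add_zero]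
  · have := norm_sub_norm_le ((2:ℝ)^j • e) (-η)
    rw [norm_neg, sub_neg_eq_add, add_comm _ η] at this
    linarith
  · have := norm_sub_norm_le ((2:ℝ)^j • e) η
    rw [norm_sub_rev] at this
    linarith

lemma aux_fNhat_compact (hs : Function.support χ ⊆ Metric.closedBall 0 (1/2))
    (δ : ℝ) (N : ℕ) : ∃ K : ℝ, ∀ η : EuclideanSpace ℝ (Fin d), K < ‖η‖ →
      fNhat d χ e δ N η = 0 := by
  refine ⟨2^(2*N) * ‖e‖ + 1, fun η h => ?_⟩
  unfold fNhat
  rw [Finset.sum_eq_zero, mul_zero]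
  intro j hj
  have hR : ‖(2:ℝ)^j • e‖ ≤ 2^(2*N) * ‖e‖ := by
    rw [norm_smul, norm_pow, Real.norm_ofNat]
    have : (2:ℝ)^j ≤ 2^(2*N) := pow_le_pow_right₀ (by norm_num) (Finset.mem_Icc.1 hj).2
    gcongr
  rw [aux_chi_zero hs, aux_chi_zero hs, add_zero]
  · have := norm_sub_norm_le η (-(2:ℝ)^j • e)
    rw [neg_smul, norm_neg, sub_neg_eq_add] at this
    linarith
  · have := norm_sub_norm_le η ((2:ℝ)^j • e)
    linarith

/-- the inner integrand -/
def auxF (d : ℕ) (χ : EuclideanSpace ℝ (Fin d) → ℝ) (e : EuclideanSpace ℝ (Fin d))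
    (δ : ℝ) (N : ℕ) (p : EuclideanSpace ℝ (Fin d) × ℝ) (η : EuclideanSpace ℝ (Fin d)) : ℝ :=
  (-(⟪η, p.1 - η⟫)) * fNhat d χ e δ N (p.1 - η) * fNhat d χ e δ N η *
      Real.exp (-p.2 * (‖η‖^2 + ‖p.1 - η‖^2))

lemma aux_contF (hχ : Continuous χ) (δ : ℝ) (N : ℕ) :
    Continuous (Function.uncurry (auxF d χ e δ N)) := by
  have := aux_cont_fNhat (e := e) hχ δ N
  unfold auxF Function.uncurry
  fun_prop

lemma aux_cont_inner (hχ : Continuous χ) (hs : Function.support χ ⊆ Metric.closedBall 0 (1/2))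
    (δ : ℝ) (N : ℕ) : Continuous (fun p => ∫ η, auxF d χ e δ N p η) := by
  obtain ⟨K, hK⟩ := aux_fNhat_compact (e := e) hs δ N
  have h := continuous_parametric_integral_of_continuous (μ := volume)
    (aux_contF (e := e) hχ δ N)
    (isCompact_closedBall (0 : EuclideanSpace ℝ (Fin d)) K)
  convert h using 2 with p
  rw [setIntegral_eq_integral_of_forall_compl_eq_zero]
  intro η hη
  simp at hη
  simp [auxF, hK η hη]

lemma aux_integrable (hχ : Continuous χ) (hs : Function.support χ ⊆ Metric.closedBall 0 (1/2))
    (δ : ℝ) (N : ℕ) (p : EuclideanSpace ℝ (Fin d) × ℝ) : Integrable (auxF d χ e δ N p) := by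
  obtain ⟨K, hK⟩ := aux_fNhat_compact (e := e) hs δ N
  have hf := aux_cont_fNhat (e := e) hχ δ N
  have hc : Continuous (auxF d χ e δ N p) := by
    unfold auxF
    fun_prop
  refine hc.integrable_of_hasCompactSupport
    (HasCompactSupport.intro (isCompact_closedBall (0 : EuclideanSpace ℝ (Fin d)) K) ?_)
  intro η hη
  simp at hη
  simp [auxF, hK η hη]

lemma aux_cont_A2 (hχ : Continuous χ) (hs : Function.support χ ⊆ Metric.closedBall 0 (1/2))
    (δ : ℝ) (N : ℕ) (t : ℝ) : Continuous (A2hat d χ e δ N t) := by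
  have h := aux_cont_inner (e := e) hχ hs δ N
  have := intervalIntegral.continuous_parametric_intervalIntegral_of_continuous' (μ := volume)
    (f := fun (ξ : EuclideanSpace ℝ (Fin d)) (τ : ℝ) => Real.exp (-(t-τ) * ‖ξ‖^2) *
      ∫ η, auxF d χ e δ N (ξ, τ) η) (by unfold Function.uncurry; fun_prop) 0 t
  exact this

/-- diagonal lower bound -/
lemma aux_diag (hχ : ∀ ξ, χ ξ ∈ Set.Icc (0:ℝ) 1) (δ : ℝ) (N : ℕ)
    (ξ η : EuclideanSpace ℝ (Fin d)) :
    (δ^2 / N) * ∑ j ∈ Finset.Icc N (2*N), χ (ξ - η + (2:ℝ)^j • e) * χ (η - (2:ℝ)^j • e) ≤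
      fNhat d χ e δ N (ξ - η) * fNhat d χ e δ N η := by
  unfold fNhat
  have h1 : (δ / Real.sqrt N) * (δ / Real.sqrt N) = δ^2 / N := by
    rw [div_mul_div_comm, Real.mul_self_sqrt (by positivity)]; ring
  rw [mul_mul_mul_comm, h1, Finset.sum_mul_sum]
  refine mul_le_mul_of_nonneg_left ?_ (by positivity)
  refine Finset.sum_le_sum fun j hj => ?_
  have h0 := fun ξ => (hχ ξ).1
  refine le_trans ?_ (Finset.single_le_sum (f := fun i =>
    (χ (ξ - η - (2:ℝ)^j • e) + χ (ξ - η + (2:ℝ)^j • e)) *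
      (χ (η - (2:ℝ)^i • e) + χ (η + (2:ℝ)^i • e))) (fun i _ => ?_) hj)
  · refine mul_le_mul ?_ ?_ (h0 _) (add_nonneg (h0 _) (h0 _))
    · linarith [h0 (ξ - η - (2:ℝ)^j • e)]
    · linarith [h0 (η + (2:ℝ)^j • e)]
  · exact mul_nonneg (add_nonneg (h0 _) (h0 _)) (add_nonneg (h0 _) (h0 _))

lemma aux_pointwise (hχ : ∀ ξ, χ ξ ∈ Set.Icc (0:ℝ) 1)
    (hs : Function.support χ ⊆ Metric.closedBall 0 (1/2))
    (hχ1 : ∀ ξ : EuclideanSpace ℝ (Fin d), ‖ξ‖ ≤ 1/4 → χ ξ = 1) (he : 1 ≤ ‖e‖)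
    (δ : ℝ) {N : ℕ} (hN : 1 ≤ N) (ξ η : EuclideanSpace ℝ (Fin d)) (hξ : ‖ξ‖ ≤ 1/6)
    {τ : ℝ} (hτ : 0 ≤ τ) :
    ∑ j ∈ Finset.Icc N (2*N), (Metric.closedBall ((2:ℝ)^j • e) (1/12)).indicator
      (fun _ => (δ^2 / N) * (‖(2:ℝ)^j • e‖^2 / 2 * Real.exp (-(4 * ‖(2:ℝ)^j • e‖^2) * τ))) η
      ≤ auxF d χ e δ N (ξ, τ) η := by
  have hin : -(⟪η, ξ - η⟫) = ‖η‖^2 - ⟪η, ξ⟫ := by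
    rw [inner_sub_right, real_inner_self_eq_norm_sq]; ring
  have hcs : ⟪η, ξ⟫ ≤ ‖η‖ * ‖ξ‖ := real_inner_le_norm _ _
  have hn := norm_nonneg η
  rcases lt_or_ge ‖η‖ (1/6) with h | h
  · simp only [auxF, aux_fNhat_small hs he δ hN η h, mul_zero, zero_mul]
    apply le_of_eq
    refine Finset.sum_eq_zero fun j hj => Set.indicator_of_notMem ?_ _
    have hR := aux_R he hN (Finset.mem_Icc.1 hj).1
    have := norm_sub_norm_le ((2:ℝ)^j • e) η
    rw [norm_sub_rev] at this
    rw [Metric.mem_closedBall, dist_eq_norm]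
    linarith
  · have hG : 0 ≤ -(⟪η, ξ - η⟫) := by rw [hin]; nlinarith
    have h1 : auxF d χ e δ N (ξ, τ) η = (-(⟪η, ξ - η⟫) *
      Real.exp (-τ * (‖η‖^2 + ‖ξ - η‖^2))) * (fNhat d χ e δ N (ξ - η) * fNhat d χ e δ N η) := by
      simp only [auxF]; ring
    rw [h1]
    refine le_trans ?_ (mul_le_mul_of_nonneg_left (aux_diag hχ δ N ξ η)
      (mul_nonneg hG (Real.exp_pos _).le))
    rw [Finset.mul_sum, Finset.mul_sum]
    refine Finset.sum_le_sum fun j hj => ?_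
    have hR := aux_R he hN (Finset.mem_Icc.1 hj).1
    have hq : 0 ≤ δ^2 / (N:ℝ) := by positivity
    by_cases hm : η ∈ Metric.closedBall ((2:ℝ)^j • e) (1/12)
    · rw [Set.indicator_of_mem hm]
      rw [Metric.mem_closedBall, dist_eq_norm] at hm
      have hm2 : ‖ξ - η + (2:ℝ)^j • e‖ ≤ 1/4 := by
        have := norm_sub_le ξ (η - (2:ℝ)^j • e)
        rw [← sub_add] at this
        linarith
      rw [hχ1 _ hm2, hχ1 _ (by linarith)]
      have a1 := norm_sub_norm_le ((2:ℝ)^j • e) η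
      rw [norm_sub_rev] at a1
      have a2 := norm_sub_norm_le η ((2:ℝ)^j • e)
      have a3 := norm_sub_le ξ η
      set R := ‖(2:ℝ)^j • e‖
      have b1 : R^2/2 ≤ -(⟪η, ξ - η⟫) := by rw [hin]; nlinarith
      have b2 : Real.exp (-(4 * R^2) * τ) ≤ Real.exp (-τ * (‖η‖^2 + ‖ξ - η‖^2)) := by
        apply Real.exp_le_exp.2
        have c1 : ‖η‖^2 ≤ 2 * R^2 := by nlinarith
        have c2 : ‖ξ - η‖^2 ≤ (R+1/4)^2 := by
          gcongr; linarith
        have c3 : (R+1/4)^2 ≤ 2 * R^2 := by nlinarith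
        have c4 := mul_le_mul_of_nonneg_left (add_le_add c1 (c2.trans c3)) hτ
        linarith
      have b3 := mul_le_mul b1 b2 (Real.exp_pos _).le hG
      have b4 := mul_le_mul_of_nonneg_left b3 hq
      linarith
    · rw [Set.indicator_of_notMem hm]
      have := (hχ (ξ - η + (2:ℝ)^j • e)).1
      have := (hχ (η - (2:ℝ)^j • e)).1
      positivity

lemma aux_inner (hχc : Continuous χ) (hχ : ∀ ξ, χ ξ ∈ Set.Icc (0:ℝ) 1)
    (hs : Function.support χ ⊆ Metric.closedBall 0 (1/2))
    (hχ1 : ∀ ξ : EuclideanSpace ℝ (Fin d), ‖ξ‖ ≤ 1/4 → χ ξ = 1) (he : 1 ≤ ‖e‖)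
    (δ : ℝ) {N : ℕ} (hN : 1 ≤ N) (ξ : EuclideanSpace ℝ (Fin d)) (hξ : ‖ξ‖ ≤ 1/6)
    {τ : ℝ} (hτ : 0 ≤ τ) :
    ∑ j ∈ Finset.Icc N (2*N), volume.real (Metric.closedBall (0:EuclideanSpace ℝ (Fin d)) (1/12)) *
      ((δ^2 / N) * (‖(2:ℝ)^j • e‖^2 / 2 * Real.exp (-(4 * ‖(2:ℝ)^j • e‖^2) * τ)))
      ≤ ∫ η, auxF d χ e δ N (ξ, τ) η := by
  have hi : ∀ j ∈ Finset.Icc N (2*N), Integrable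
      ((Metric.closedBall ((2:ℝ)^j • e) (1/12)).indicator
      (fun _ => (δ^2 / N) * (‖(2:ℝ)^j • e‖^2 / 2 *
        Real.exp (-(4 * ‖(2:ℝ)^j • e‖^2) * τ)))) := by
    intro j _
    rw [integrable_indicator_iff Metric.isClosed_closedBall.measurableSet]
    exact integrableOn_const (measure_closedBall_lt_top.ne)
  have := integral_mono (integrable_finsetSum _ hi) (aux_integrable hχc hs δ N (ξ, τ))
    (fun η => by
      have := aux_pointwise hχ hs hχ1 he δ hN ξ η hξ hτ
      simpa only [Finset.sum_apply] using this)
  refine le_trans (le_of_eq ?_) this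
  rw [integral_finsetSum _ hi]
  refine Finset.sum_congr rfl fun j _ => ?_
  rw [integral_indicator Metric.isClosed_closedBall.measurableSet, setIntegral_const, smul_eq_mul]
  congr 1
  simp only [Measure.real]
  rw [Measure.addHaar_closedBall_center volume ((2:ℝ)^j • e)]

lemma aux_time (a t : ℝ) (ha : 0 < a) (hta : 1 ≤ t * a) :
    1/16 ≤ ∫ τ in (0:ℝ)..t, a / 2 * Real.exp (-(4 * a) * τ) := by
  have h : ∀ τ ∈ Set.uIcc 0 t, HasDerivAt (fun τ => -(1/8) * Real.exp (-(4 * a) * τ))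
      (a / 2 * Real.exp (-(4 * a) * τ)) τ := by
    intro τ _
    have := (((hasDerivAt_id τ).const_mul (-(4*a))).exp).const_mul (-(1/8))
    refine this.congr_deriv ?_
    simp only [id]
    ring
  rw [intervalIntegral.integral_eq_sub_of_hasDerivAt h
    (Continuous.intervalIntegrable (by fun_prop) _ _)]
  have h1 : Real.exp (-(4 * a) * t) ≤ 1/2 := by
    have h2 : Real.exp (-(4 * a) * t) ≤ Real.exp (-1) := Real.exp_le_exp.2 (by nlinarith)
    have := Real.exp_neg_one_lt_half
    linarith
  simp only [mul_zero, Real.exp_zero]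
  linarith

lemma aux_A2 (hχc : Continuous χ) (hχ : ∀ ξ, χ ξ ∈ Set.Icc (0:ℝ) 1)
    (hs : Function.support χ ⊆ Metric.closedBall 0 (1/2))
    (hχ1 : ∀ ξ : EuclideanSpace ℝ (Fin d), ‖ξ‖ ≤ 1/4 → χ ξ = 1) (he : 1 ≤ ‖e‖)
    (δ : ℝ) {N : ℕ} (hN : 1 ≤ N) (ξ : EuclideanSpace ℝ (Fin d)) (hξ : ‖ξ‖ ≤ 1/6) :
    Real.exp (-1) * volume.real (Metric.closedBall (0:EuclideanSpace ℝ (Fin d)) (1/12)) / 16 * δ^2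
      ≤ A2hat d χ e δ N ((2:ℝ)^(-(N:ℤ))) ξ := by
  set t : ℝ := (2:ℝ)^(-(N:ℤ)) with ht
  set v := volume.real (Metric.closedBall (0:EuclideanSpace ℝ (Fin d)) (1/12)) with hv
  have hv0 : 0 ≤ v := measureReal_nonneg
  have ht0 : 0 < t := by positivity
  have htN : t * 2^N = 1 := by
    rw [ht, zpow_neg, zpow_natCast]; field_simp
  have ht1 : t ≤ 1 := by
    have : (1:ℝ) ≤ 2^N := one_le_pow₀ (by norm_num)
    nlinarith
  have hN0 : (0:ℝ) < N := by exact_mod_cast hN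
  have hmono : ∫ τ in (0:ℝ)..t, Real.exp (-1) * ∑ j ∈ Finset.Icc N (2*N), v *
      ((δ^2 / N) * (‖(2:ℝ)^j • e‖^2 / 2 * Real.exp (-(4 * ‖(2:ℝ)^j • e‖^2) * τ)))
      ≤ A2hat d χ e δ N t ξ := by
    unfold A2hat
    have hc := aux_cont_inner (e := e) hχc hs δ N
    apply intervalIntegral.integral_mono_on ht0.le
    · exact Continuous.intervalIntegrable (by fun_prop) _ _
    · have : Continuous fun τ : ℝ => Real.exp (-(t-τ) * ‖ξ‖^2) *
          ∫ η, auxF d χ e δ N (ξ, τ) η :=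
        Continuous.mul (by fun_prop)
          (hc.comp (f := fun τ : ℝ => (ξ, τ)) (by fun_prop))
      exact this.intervalIntegrable _ _
    · intro τ hτ
      refine mul_le_mul ?_ (aux_inner hχc hχ hs hχ1 he δ hN ξ hξ hτ.1) ?_ (Real.exp_pos _).le
      · apply Real.exp_le_exp.2
        have : ‖ξ‖^2 ≤ 1 := by nlinarith [norm_nonneg ξ]
        nlinarith [hτ.1, hτ.2, sq_nonneg ‖ξ‖]
      · exact Finset.sum_nonneg fun j _ => by positivity
  refine le_trans ?_ hmono
  rw [intervalIntegral.integral_const_mul, intervalIntegral.integral_finsetSum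
    (fun j _ => Continuous.intervalIntegrable (by fun_prop) _ _)]
  have hsum : ∑ j ∈ Finset.Icc N (2*N), v * ((δ^2 / N) * (1/16)) ≤
      ∑ j ∈ Finset.Icc N (2*N), ∫ τ in (0:ℝ)..t, v *
      ((δ^2 / N) * (‖(2:ℝ)^j • e‖^2 / 2 * Real.exp (-(4 * ‖(2:ℝ)^j • e‖^2) * τ))) := by
    refine Finset.sum_le_sum fun j hj => ?_
    rw [intervalIntegral.integral_const_mul, intervalIntegral.integral_const_mul]
    have hR : (2:ℝ)^N ≤ ‖(2:ℝ)^j • e‖ := by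
      rw [norm_smul, norm_pow, Real.norm_ofNat]
      have : (2:ℝ)^N ≤ 2^j := pow_le_pow_right₀ (by norm_num) (Finset.mem_Icc.1 hj).1
      nlinarith [show (0:ℝ) < 2^j by positivity]
    have h2N : (1:ℝ) ≤ 2^N := one_le_pow₀ (by norm_num)
    have := aux_time (‖(2:ℝ)^j • e‖^2) t (by nlinarith) (by
      rw [← htN]; gcongr; nlinarith)
    gcongr
  refine le_trans ?_ (mul_le_mul_of_nonneg_left hsum (Real.exp_pos _).le)
  rw [Finset.sum_const, Nat.card_Icc, nsmul_eq_mul]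
  have hcard : ((2 * N + 1 - N : ℕ) : ℝ) = N + 1 := by
    rw [show 2 * N + 1 - N = N + 1 by omega]; push_cast; ring
  rw [hcard]
  have h3 : δ^2 ≤ (N+1) * (δ^2 / N) := by
    rw [mul_div_assoc', le_div_iff₀ hN0]; nlinarith [sq_nonneg δ]
  have := mul_le_mul_of_nonneg_left h3 (show 0 ≤ Real.exp (-1) * v / 16 by positivity)
  linarith

end helpers

/-- at time `t_N = 2^{-N}`, the Littlewood–Paley block at scale `2^{-4}`
of the second iterate satisfies `‖Δ̇_{-4}[A₂(f^N)](t_N)‖_{L^∞} ≥ c δ²` for all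
sufficiently large `N`, with `c > 0` independent of `N` and `δ`. -/
theorem stmt12 (d : ℕ) (hd : 1 ≤ d)
    (φ : EuclideanSpace ℝ (Fin d) → ℝ) (hφ_cont : Continuous φ)
    (hφ_range : ∀ ξ, φ ξ ∈ Set.Icc (0:ℝ) 1)
    (hφ_supp : Function.support φ ⊆
      {ξ : EuclideanSpace ℝ (Fin d) | 3/4 ≤ ‖ξ‖ ∧ ‖ξ‖ ≤ 8/3})
    (hφ_one : ∀ ξ : EuclideanSpace ℝ (Fin d), 4/3 ≤ ‖ξ‖ → ‖ξ‖ ≤ 3/2 → φ ξ = 1)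
    (χ : EuclideanSpace ℝ (Fin d) → ℝ) (hχ_cont : Continuous χ)
    (hχ_range : ∀ ξ, χ ξ ∈ Set.Icc (0:ℝ) 1)
    (hχ_supp : Function.support χ ⊆ Metric.closedBall 0 (1/2))
    (hχ_one : ∀ ξ : EuclideanSpace ℝ (Fin d), ‖ξ‖ ≤ 1/4 → χ ξ = 1)
    (e : EuclideanSpace ℝ (Fin d)) (he : ∀ i, e i = 1) :
    ∃ c : ℝ, 0 < c ∧ ∃ N₀ : ℕ, ∀ δ : ℝ, 0 < δ → δ ≤ 1 → ∀ N : ℕ, N₀ ≤ N →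
      c * δ^2 ≤
        ⨆ x : EuclideanSpace ℝ (Fin d),
          ‖∫ ξ, Complex.exp (Complex.I * ((⟪x, ξ⟫ : ℝ) : ℂ)) *
              ((φ ((16:ℝ) • ξ) * A2hat d χ e δ N ((2:ℝ)^(-(N:ℤ))) ξ : ℝ) : ℂ)‖ := by
  have hd0 : 0 < d := hd
  have hen : 1 ≤ ‖e‖ := by
    have := PiLp.norm_apply_le e ⟨0, hd0⟩
    rw [he] at this
    simpa using this
  set g : EuclideanSpace ℝ (Fin d) → ℝ := fun ξ => φ ((16:ℝ) • ξ) with hg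
  have hgc : Continuous g := by fun_prop
  have hg0 : 0 ≤ g := fun ξ => (hφ_range _).1
  have hgz : ∀ ξ, 1/6 < ‖ξ‖ → g ξ = 0 := by
    intro ξ h
    by_contra h0
    have h1 := (hφ_supp h0).2
    rw [norm_smul, Real.norm_ofNat] at h1
    linarith
  have hgs : HasCompactSupport g :=
    HasCompactSupport.intro (isCompact_closedBall (0 : EuclideanSpace ℝ (Fin d)) (1/6))
      (fun ξ hξ => hgz ξ (by simpa using hξ))
  have hgi : 0 < ∫ ξ, g ξ := by
    refine hgc.integral_pos_of_hasCompactSupport_nonneg_nonzero (x := ((1/12) * ‖e‖⁻¹) • e) hgs hg0 ?_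
    have hnorm : ‖(16:ℝ) • ((1/12) * ‖e‖⁻¹) • e‖ = 4/3 := by
      rw [norm_smul, norm_smul, norm_mul, norm_inv, norm_norm]
      have : ‖e‖ ≠ 0 := by positivity
      field_simp
      norm_num
    have : g (((1/12) * ‖e‖⁻¹) • e) = 1 :=
      hφ_one _ (by rw [hnorm]) (by rw [hnorm]; norm_num)
    rw [this]; exact one_ne_zero
  set c0 := Real.exp (-1) *
    volume.real (Metric.closedBall (0:EuclideanSpace ℝ (Fin d)) (1/12)) / 16 with hc0
  have hv : 0 < volume.real (Metric.closedBall (0:EuclideanSpace ℝ (Fin d)) (1/12)) :=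
    ENNReal.toReal_pos (Metric.measure_closedBall_pos volume _ (by norm_num)).ne'
      measure_closedBall_lt_top.ne
  refine ⟨c0 * ∫ ξ, g ξ, by positivity, 1, fun δ hδ _ N hN => ?_⟩
  have hAc := aux_cont_A2 (e := e) hχ_cont hχ_supp δ N ((2:ℝ)^(-(N:ℤ)))
  have hgAint : Integrable (fun ξ => g ξ * A2hat d χ e δ N ((2:ℝ)^(-(N:ℤ))) ξ) :=
    (hgc.mul hAc).integrable_of_hasCompactSupport hgs.mul_right
  have hlow : c0 * (∫ ξ, g ξ) * δ^2 ≤ ∫ ξ, g ξ * A2hat d χ e δ N ((2:ℝ)^(-(N:ℤ))) ξ := by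
    have h1 : c0 * (∫ ξ, g ξ) * δ^2 = ∫ ξ, g ξ * (c0 * δ^2) := by
      rw [integral_mul_const]; ring
    rw [h1]
    refine integral_mono ((hgc.integrable_of_hasCompactSupport hgs).mul_const _) hgAint ?_
    intro ξ
    rcases lt_or_ge (1/6) ‖ξ‖ with h | h
    · simp [hgz ξ h]
    · exact mul_le_mul_of_nonneg_left
        (aux_A2 hχ_cont hχ_range hχ_supp hχ_one hen δ hN ξ h) (hg0 ξ)
  have hbdd : BddAbove (Set.range fun x : EuclideanSpace ℝ (Fin d) =>
      ‖∫ ξ, Complex.exp (Complex.I * ((⟪x, ξ⟫ : ℝ) : ℂ)) *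
              ((φ ((16:ℝ) • ξ) * A2hat d χ e δ N ((2:ℝ)^(-(N:ℤ))) ξ : ℝ) : ℂ)‖) := by
    refine ⟨∫ ξ, ‖g ξ * A2hat d χ e δ N ((2:ℝ)^(-(N:ℤ))) ξ‖, ?_⟩
    rintro _ ⟨x, rfl⟩
    refine (norm_integral_le_integral_norm _).trans (le_of_eq ?_)
    congr 1
    ext ξ
    rw [norm_mul, mul_comm Complex.I, Complex.norm_exp_ofReal_mul_I, one_mul, Complex.norm_real]
  refine hlow.trans (le_trans ?_ (le_ciSup hbdd 0))
  have h0 : (∫ ξ, Complex.exp (Complex.I * ((⟪(0 : EuclideanSpace ℝ (Fin d)), ξ⟫ : ℝ) : ℂ)) *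
      ((φ ((16:ℝ) • ξ) * A2hat d χ e δ N ((2:ℝ)^(-(N:ℤ))) ξ : ℝ) : ℂ)) =
      ((∫ ξ, g ξ * A2hat d χ e δ N ((2:ℝ)^(-(N:ℤ))) ξ : ℝ) : ℂ) := by
    rw [← integral_complex_ofReal]
    congr 1
    ext ξ
    rw [inner_zero_left, Complex.ofReal_zero, mul_zero, Complex.exp_zero, one_mul]
  simp only [h0, Complex.norm_real]
  exact le_abs_self _

end
end

section
/- For any r ≥ 2, j ∈ ℤ, t > 0, and f ∈ L^∞(ℝ^d) with tempered distribution Fourier support contained anywhere, the Fourier multiplier with symbol (t|ξ|²)^{r−1} φ(2^{−j}ξ) (φ the standard dyadic bump supported in 3/4 ≤ |ξ| ≤ 8/3) satisfies ‖F⁻¹((t|ξ|²)^{r−1} φ(2^{−j}ξ) f̂)‖_{L^∞} ≤ C (t 2^{2j})^{r−1} 9^r r^d ‖f‖_{L^∞}, with C independent of r, j, t. -/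
open MeasureTheory RealInnerProductSpace

open scoped FourierTransform SchwartzMap Nat in
lemma aux_normsq {E : Type*} [NormedAddCommGroup E] [InnerProductSpace ℝ E] (x : E)
    (hx : ‖x‖ ≤ 8/3) (i : ℕ) :
    ‖iteratedFDeriv ℝ i (fun y : E => ‖y‖^2) x‖ ≤
      (i ! : ℝ) * 3^i * (if i = 0 then 64/9 else if i = 1 then 16/9 else if i = 2 then 1/9 else 0) := by
  have hfd : fderiv ℝ (fun y : E => ‖y‖^2) = fun y => (2 • (innerSL ℝ (E := E))) y := by
    rw [fderiv_norm_sq]; rfl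
  have hL : ‖(2 • (innerSL ℝ (E := E)))‖ ≤ 2 := by
    refine ContinuousLinearMap.opNorm_le_bound _ (by norm_num) fun y => ?_
    rw [smul_apply, two_nsmul]
    refine (norm_add_le _ _).trans ?_
    simp [innerSL_apply_norm]
    linarith
  match i with
  | 0 =>
    simp
    nlinarith [norm_nonneg x]
  | 1 =>
    rw [← norm_iteratedFDeriv_fderiv, norm_iteratedFDeriv_zero, hfd]
    have := (2 • (innerSL ℝ (E := E))).le_opNorm x
    have h2 := mul_le_mul hL hx (norm_nonneg x) (by norm_num)
    refine this.trans (h2.trans ?_)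
    norm_num
  | 2 =>
    rw [← norm_iteratedFDeriv_fderiv, ← norm_iteratedFDeriv_fderiv, norm_iteratedFDeriv_zero, hfd,
      ContinuousLinearMap.fderiv]
    norm_num [Nat.factorial]
    simpa using hL
  | k + 3 =>
    rw [← norm_iteratedFDeriv_fderiv, ← norm_iteratedFDeriv_fderiv, hfd]
    have : fderiv ℝ (fun y => (2 • (innerSL ℝ (E := E))) y) = fun _ => (2 • (innerSL ℝ (E := E))) := by
      ext1 y
      exact ContinuousLinearMap.fderiv _
    rw [this, iteratedFDeriv_succ_const]
    simp

open scoped Nat in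
lemma aux_step {E : Type*} [NormedAddCommGroup E] [InnerProductSpace ℝ E] (x : E)
    (hx : ‖x‖ ≤ 8/3) (h : E → ℂ) (hh : ContDiff ℝ (⊤ : ℕ∞) h) (B : ℝ) (hB : 0 ≤ B) (L : ℕ)
    (hb : ∀ l ≤ L, ‖iteratedFDeriv ℝ l h x‖ ≤ B * ((l ! : ℝ) * 3^l)) :
    ∀ l ≤ L, ‖iteratedFDeriv ℝ l (fun y => (‖y‖^2) • h y) x‖ ≤ 9 * B * ((l ! : ℝ) * 3^l) := by
  intro l hl
  have h1 := norm_iteratedFDeriv_smul_le (𝕜 := ℝ) (N := ((⊤ : ℕ∞) : WithTop ℕ∞))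
    (f := fun y : E => ‖y‖^2) (contDiff_norm_sq ℝ) hh x (n := l) (by exact_mod_cast le_top)
  refine h1.trans ?_
  set a : ℕ → ℝ := fun i => if i = 0 then 64/9 else if i = 1 then 16/9 else if i = 2 then 1/9 else 0
    with ha
  have ha0 : ∀ i, 0 ≤ a i := by
    intro i; simp only [ha]; split_ifs <;> norm_num
  have hsum : ∑ i ∈ Finset.range (l+1), a i ≤ 9 := by
    have : ∑ i ∈ Finset.range (l+1), a i ≤ ∑ i ∈ Finset.range (l+3), a i :=
      Finset.sum_le_sum_of_subset_of_nonneg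
        (Finset.range_mono (by omega)) (fun i _ _ => ha0 i)
    refine this.trans ?_
    rw [Finset.sum_range_succ', Finset.sum_range_succ', Finset.sum_range_succ']
    simp [ha]
    norm_num
  calc _ ≤ ∑ i ∈ Finset.range (l+1), (B * ((l ! : ℝ) * 3^l)) * a i := by
        refine Finset.sum_le_sum fun i hi => ?_
        have hil : i ≤ l := by simpa [Nat.lt_succ_iff] using hi
        have e1 := aux_normsq x hx i
        have e2 := hb (l - i) (by omega)
        have hf : ((l.choose i : ℕ) : ℝ) * (i ! : ℝ) * ((l - i)! : ℝ) = (l ! : ℝ) := by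
          exact_mod_cast Nat.choose_mul_factorial_mul_factorial hil
        have h3 : (3:ℝ)^l = 3^i * 3^(l-i) := by rw [← pow_add]; congr 1; omega
        have hai := ha0 i
        calc _ ≤ (l.choose i : ℝ) * ((i ! : ℝ) * 3^i * a i) * (B * (((l-i)! : ℝ) * 3^(l-i))) := by
              gcongr
          _ = _ := by rw [← hf, h3]; ring
    _ = (B * ((l ! : ℝ) * 3^l)) * ∑ i ∈ Finset.range (l+1), a i := by rw [Finset.mul_sum]
    _ ≤ (B * ((l ! : ℝ) * 3^l)) * 9 := by gcongr
    _ = _ := by ring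

open scoped FourierTransform SchwartzMap Nat in
lemma aux_schwartz (d : ℕ)
    (p : EuclideanSpace ℝ (Fin d) → ℝ) (hp_smooth : ContDiff ℝ (⊤ : ℕ∞) p)
    (hp_supp : Function.support p ⊆
      {ξ : EuclideanSpace ℝ (Fin d) | 3/4 ≤ ‖ξ‖ ∧ ‖ξ‖ ≤ 8/3}) :
    ∃ C : ℝ, 0 < C ∧ ∀ n : ℕ, ∃ G : 𝓢(EuclideanSpace ℝ (Fin d), ℂ),
      (∀ x, G x = (((‖x‖^2)^n * p x : ℝ) : ℂ)) ∧ ∫ x, ‖(𝓕⁻ G) x‖ ≤ C * 9^n := by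
  let E := EuclideanSpace ℝ (Fin d)
  let g : ℕ → E → ℂ := fun n x => (((‖x‖^2)^n * p x : ℝ) : ℂ)
  have hg_smooth : ∀ n, ContDiff ℝ (⊤ : ℕ∞) (g n) := fun n =>
    Complex.ofRealCLM.contDiff.comp (((contDiff_norm_sq ℝ).pow n).mul hp_smooth)
  have hg_ts : ∀ n, tsupport (g n) ⊆ Metric.closedBall 0 (8/3) := by
    intro n
    refine closure_minimal ?_ Metric.isClosed_closedBall
    intro x hx
    have : p x ≠ 0 := by
      intro h0; apply hx; simp [g, h0]
    simpa using (hp_supp this).2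
  have hg_cs : ∀ n, HasCompactSupport (g n) := fun n =>
    (isCompact_closedBall (0:E) (8/3)).of_isClosed_subset isClosed_closure (hg_ts n)
  let G : ℕ → 𝓢(E, ℂ) := fun n => (hg_cs n).toSchwartzMap (hg_smooth n)
  have hG : ∀ n, (G n : E → ℂ) = g n := fun n => rfl
  let T : 𝓢(E, ℂ) →L[ℂ] Lp ℂ 1 (volume : Measure E) :=
    (SchwartzMap.toLpCLM ℂ ℂ 1 volume).comp
      ((FourierTransform.fourierCLE ℂ 𝓢(E, ℂ)).symm : 𝓢(E, ℂ) →L[ℂ] 𝓢(E, ℂ))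
  have hT : ∀ f, ‖T f‖ = ∫ x, ‖(𝓕⁻ f) x‖ := by
    intro f
    have : T f = (𝓕⁻ f).toLp 1 volume := rfl
    rw [this, SchwartzMap.norm_toLp_one]
  obtain ⟨s, c, hc, hs⟩ := Seminorm.bound_of_continuous (schwartz_withSeminorms ℂ E ℂ)
    ((normSeminorm ℂ (Lp ℂ 1 (volume : Measure E))).comp (T : 𝓢(E, ℂ) →ₗ[ℂ] _))
    (by exact continuous_norm.comp T.continuous)
  -- bound on the derivatives of p
  let L := s.sup Prod.snd
  let K := s.sup Prod.fst
  let B : ℝ := ∑ l ∈ Finset.range (L+1), SchwartzMap.seminorm ℝ 0 l (G 0)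
  have hB0 : 0 ≤ B := Finset.sum_nonneg fun _ _ => apply_nonneg _ _
  have hbase : ∀ x, ∀ l ≤ L, ‖iteratedFDeriv ℝ l (g 0) x‖ ≤ B * ((l ! : ℝ) * 3^l) := by
    intro x l hl
    have h1 : ‖iteratedFDeriv ℝ l (g 0) x‖ ≤ SchwartzMap.seminorm ℝ 0 l (G 0) := by
      have h0 := SchwartzMap.le_seminorm ℝ 0 l (G 0) x
      rw [pow_zero, one_mul, hG] at h0
      exact h0
    have h2 : SchwartzMap.seminorm ℝ 0 l (G 0) ≤ B :=
      Finset.single_le_sum (f := fun l => SchwartzMap.seminorm ℝ 0 l (G 0))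
        (fun _ _ => apply_nonneg _ _) (by simp; omega)
    have h3 : (1:ℝ) ≤ (l ! : ℝ) * 3^l := by
      have : (1:ℝ) ≤ (l ! : ℝ) := by exact_mod_cast Nat.one_le_iff_ne_zero.mpr (Nat.factorial_ne_zero l)
      exact one_le_mul_of_one_le_of_one_le this (one_le_pow₀ (by norm_num))
    nlinarith
  have hind : ∀ n x, ‖x‖ ≤ 8/3 → ∀ l ≤ L,
      ‖iteratedFDeriv ℝ l (g n) x‖ ≤ (9^n * B) * ((l ! : ℝ) * 3^l) := by
    intro n x hx
    induction n with
    | zero => simpa using hbase x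
    | succ n ih =>
      have e : g (n+1) = fun y => (‖y‖^2) • g n y := by
        ext y
        simp only [g, Complex.real_smul]
        push_cast
        ring
      rw [e]
      intro l hl
      have := aux_step x hx (g n) (hg_smooth n) (9^n * B) (by positivity) L ih l hl
      refine this.trans (le_of_eq ?_)
      ring
  let D : ℝ := (3:ℝ)^K * (B * ((L ! : ℝ) * 3^L))
  have hD0 : 0 ≤ D := by positivity
  refine ⟨c * D + 1, by positivity, fun n => ⟨G n, fun x => rfl, ?_⟩⟩
  rw [← hT]
  have h1 := hs (G n)
  have h2 : (s.sup (schwartzSeminormFamily ℂ E ℂ)) (G n) ≤ D * 9^n := by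
    refine Seminorm.finset_sup_apply_le (by positivity) ?_
    rintro ⟨k, l⟩ hkl
    have hl : l ≤ L := Finset.le_sup (f := Prod.snd) hkl
    have hk : k ≤ K := Finset.le_sup (f := Prod.fst) hkl
    refine SchwartzMap.seminorm_le_bound ℂ k l (G n) (by positivity) fun x => ?_
    rw [hG]
    by_cases hx : ‖x‖ ≤ 8/3
    · have e := hind n x hx l hl
      have e1 : ‖x‖^k ≤ 3^K := by
        calc ‖x‖^k ≤ 3^k := by gcongr; linarith
          _ ≤ 3^K := pow_le_pow_right₀ (by norm_num) hk
      have e2 : (l ! : ℝ) ≤ L ! := by exact_mod_cast Nat.factorial_le hl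
      have e3 : (3:ℝ)^l ≤ 3^L := pow_le_pow_right₀ (by norm_num) hl
      calc _ ≤ 3^K * ((9^n * B) * ((l ! : ℝ) * 3^l)) := by gcongr
        _ ≤ 3^K * ((9^n * B) * ((L ! : ℝ) * 3^L)) := by gcongr
        _ = _ := by simp only [D]; ring
    · have : iteratedFDeriv ℝ l (g n) x = 0 := by
        by_contra hne
        exact hx (by simpa using hg_ts n (support_iteratedFDeriv_subset l hne))
      rw [this]
      simp
      positivity
  have h3 : ‖T (G n)‖ ≤ c * (s.sup (schwartzSeminormFamily ℂ E ℂ)) (G n) := h1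
  calc _ ≤ c * (s.sup (schwartzSeminormFamily ℂ E ℂ)) (G n) := h3
    _ ≤ c * (D * 9^n) := by gcongr
    _ ≤ _ := by nlinarith [pow_pos (show (0:ℝ) < 9 by norm_num) n]

open scoped FourierTransform SchwartzMap in
lemma aux_kernel (d : ℕ) (φ : EuclideanSpace ℝ (Fin d) → ℝ) (n : ℕ)
    (G : 𝓢(EuclideanSpace ℝ (Fin d), ℂ))
    (hG : ∀ x, G x = (((‖x‖^2)^n * φ x : ℝ) : ℂ)) (j : ℤ) (t : ℝ)
    (x : EuclideanSpace ℝ (Fin d)) :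
    (∫ ξ, Complex.exp (Complex.I * ((⟪x, ξ⟫ : ℝ) : ℂ)) *
            (((t * ‖ξ‖^2)^n * φ ((2:ℝ)^(-j) • ξ) : ℝ) : ℂ)) =
      (((t * (2:ℝ)^(2*j))^n * ((2:ℝ)^j)^d : ℝ) : ℂ) *
        (𝓕⁻ G) (((2:ℝ)^j / (2 * Real.pi)) • x) := by
  have h2 : (0:ℝ) < (2:ℝ)^j := by positivity
  let F : EuclideanSpace ℝ (Fin d) → ℂ := fun η =>
    Complex.exp (Complex.I * ((⟪x, (2:ℝ)^j • η⟫ : ℝ) : ℂ)) *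
      ((((t * (2:ℝ)^(2*j))^n : ℝ) : ℂ) * G η)
  have e1 : ∀ ξ, Complex.exp (Complex.I * ((⟪x, ξ⟫ : ℝ) : ℂ)) *
            (((t * ‖ξ‖^2)^n * φ ((2:ℝ)^(-j) • ξ) : ℝ) : ℂ) = F (((2:ℝ)^j)⁻¹ • ξ) := by
    intro ξ
    simp only [F, smul_smul, mul_inv_cancel₀ h2.ne', one_smul, hG]
    congr 1
    rw [← Complex.ofReal_mul, norm_smul, zpow_neg]
    congr 1
    rw [← mul_assoc, ← mul_pow]
    congr 2
    rw [norm_inv, Real.norm_of_nonneg h2.le, two_mul, zpow_add₀ (by norm_num)]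
    field_simp
  simp_rw [e1]
  rw [Measure.integral_comp_inv_smul, SchwartzMap.fourierInv_coe, Real.fourierInv_eq',
    abs_of_nonneg (by positivity)]
  simp only [finrank_euclideanSpace, Fintype.card_fin, F]
  rw [Complex.real_smul]
  rw [Complex.ofReal_mul, mul_comm (((t * (2:ℝ)^(2*j))^n : ℝ) : ℂ), mul_assoc,
    ← integral_const_mul (((t * (2:ℝ)^(2*j))^n : ℝ) : ℂ)]
  congr 1
  refine integral_congr_ae (Filter.Eventually.of_forall fun η => ?_)
  simp only [smul_eq_mul]
  rw [mul_left_comm]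
  congr 3
  rw [inner_smul_right, inner_smul_right, real_inner_comm, mul_comm]
  congr 2
  have := Real.pi_pos
  field_simp

/-- Bernstein-type multiplier estimate. For the symbol
`m(ξ) = (t|ξ|²)^{r-1} φ(2^{-j}ξ)` with `φ` the standard dyadic bump, the kernel
`F⁻¹ m` has `L¹` norm at most `C (t 2^{2j})^{r-1} 9^r r^d`, and hence the associated
Fourier multiplier is bounded on `L^∞` with the same bound, with `C` independent of
`r ≥ 2`, `j` and `t > 0`. -/
theorem stmt14 (d : ℕ) (hd : 1 ≤ d)
    (φ : EuclideanSpace ℝ (Fin d) → ℝ) (hφ_smooth : ContDiff ℝ (⊤ : ℕ∞) φ)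
    (hφ_range : ∀ ξ, φ ξ ∈ Set.Icc (0:ℝ) 1)
    (hφ_supp : Function.support φ ⊆
      {ξ : EuclideanSpace ℝ (Fin d) | 3/4 ≤ ‖ξ‖ ∧ ‖ξ‖ ≤ 8/3}) :
    ∃ C : ℝ, 0 < C ∧ ∀ (r : ℕ), 2 ≤ r → ∀ (j : ℤ) (t : ℝ), 0 < t →
      (∫ x : EuclideanSpace ℝ (Fin d),
          ‖∫ ξ, Complex.exp (Complex.I * ((⟪x, ξ⟫ : ℝ) : ℂ)) *
            (((t * ‖ξ‖^2)^(r-1) * φ ((2:ℝ)^(-j) • ξ) : ℝ) : ℂ)‖) ≤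
        C * (t * (2:ℝ)^(2*j))^(r-1) * 9^r * (r:ℝ)^d ∧
      ∀ (f : EuclideanSpace ℝ (Fin d) → ℂ) (A : ℝ), (∀ y, ‖f y‖ ≤ A) →
        ∀ x : EuclideanSpace ℝ (Fin d),
          ‖∫ y, (∫ ξ, Complex.exp (Complex.I * ((⟪x - y, ξ⟫ : ℝ) : ℂ)) *
              (((t * ‖ξ‖^2)^(r-1) * φ ((2:ℝ)^(-j) • ξ) : ℝ) : ℂ)) * f y‖ ≤
            C * (t * (2:ℝ)^(2*j))^(r-1) * 9^r * (r:ℝ)^d * A := by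
  obtain ⟨C, hC, hCn⟩ := aux_schwartz d φ hφ_smooth hφ_supp
  have hpi := Real.pi_pos
  refine ⟨(2 * Real.pi)^d * C, by positivity, fun r hr j t ht => ?_⟩
  obtain ⟨G, hG, hGb⟩ := hCn (r-1)
  have h2 : (0:ℝ) < (2:ℝ)^j := by positivity
  have hR : (2:ℝ)^j / (2 * Real.pi) ≠ 0 := by positivity
  simp_rw [aux_kernel d φ (r-1) G hG j t]
  set H := FourierTransformInv.fourierInv G with hH
  set R : ℝ := (2:ℝ)^j / (2 * Real.pi) with hRdef
  set k : ℝ := (t * (2:ℝ)^(2*j))^(r-1) with hk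
  have hk0 : 0 ≤ k := by positivity
  let N : EuclideanSpace ℝ (Fin d) → ℝ := fun x => ‖((k * ((2:ℝ)^j)^d : ℝ) : ℂ) * H (R • x)‖
  have hNint : Integrable N := by
    have h1 : Integrable (fun x => H (R • x)) := (H.integrable (μ := volume)).comp_smul hR
    exact (h1.const_mul _).norm
  have hNb : ∫ x, N x ≤ (2 * Real.pi)^d * C * k * 9^r * (r:ℝ)^d := by
    have e : ∫ x, N x = (2 * Real.pi)^d * k * ∫ x, ‖H x‖ := by
      simp only [N, norm_mul, Complex.norm_real]
      rw [integral_const_mul, Measure.integral_comp_smul volume (fun x => ‖H x‖) R]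
      simp only [finrank_euclideanSpace, Fintype.card_fin, smul_eq_mul]
      rw [abs_of_nonneg (by positivity), Real.norm_of_nonneg hk0,
        Real.norm_of_nonneg (by positivity), hRdef, div_pow]
      field_simp
    rw [e]
    have hr1 : (1:ℝ) ≤ (r:ℝ)^d := one_le_pow₀ (by exact_mod_cast (by omega : 1 ≤ r))
    have h9 : (9:ℝ)^(r-1) ≤ 9^r := pow_le_pow_right₀ (by norm_num) (by omega)
    calc _ ≤ (2 * Real.pi)^d * k * (C * 9^(r-1)) := by gcongr
      _ ≤ (2 * Real.pi)^d * k * (C * 9^r) := by gcongr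
      _ = (2 * Real.pi)^d * C * k * 9^r * 1 := by ring
      _ ≤ _ := by gcongr
  refine ⟨hNb, fun f A hA x => ?_⟩
  have hA0 : 0 ≤ A := (norm_nonneg _).trans (hA 0)
  have hint : Integrable (fun y => N (x - y) * A) := (hNint.comp_sub_left x).mul_const A
  refine (norm_integral_le_of_norm_le hint (Filter.Eventually.of_forall fun y => ?_)).trans ?_
  · rw [norm_mul]
    exact mul_le_mul_of_nonneg_left (hA y) (norm_nonneg _)
  · rw [integral_mul_const, integral_sub_left_eq_self N volume x]
    gcongr
end

section
/- Let d ≥ 1, p, ρ, σ ∈ [1,∞], q ∈ [1,∞), s > d/q. Then there is C = C(d,p,q), independent of ρ and σ, such that for all u ∈ Ḃ^{d/p}_{p,ρ} ∩ B^s_{q,σ}: ‖u‖_{L^∞} ≤ C (1 + ‖u‖_{Ḃ^{d/p}_{p,ρ}} (ln(e + ‖u‖_{B^s_{q,σ}}))^{1−1/ρ}). -/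
open MeasureTheory RealInnerProductSpace
open scoped ENNReal

noncomputable section

/-- Fourier transform, convention `FT f ξ = ∫ e^{-i x·ξ} f x dx`. -/
def FT (d : ℕ) (f : EuclideanSpace ℝ (Fin d) → ℂ) (ξ : EuclideanSpace ℝ (Fin d)) : ℂ :=
  ∫ x, Complex.exp (-Complex.I * ((⟪x, ξ⟫ : ℝ) : ℂ)) * f x

/-- Homogeneous Littlewood–Paley block `Δ̇_j u = 2^{jd} ǩ(2^j ·) ⋆ u`, where `ǩ` has
Fourier transform `φ` (so that `Δ̇_j u = F⁻¹(φ(2^{-j}·) û)`). -/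
def hblock (d : ℕ) (k : EuclideanSpace ℝ (Fin d) → ℂ) (j : ℤ)
    (u : EuclideanSpace ℝ (Fin d) → ℂ) (x : EuclideanSpace ℝ (Fin d)) : ℂ :=
  ∫ y, (((((2:ℝ)^j)^d : ℝ)) : ℂ) * k ((2:ℝ)^j • (x - y)) * u y

/-- Low-frequency block `Δ_{-1} u = ǩ₀ ⋆ u`, where `ǩ₀` has Fourier transform `Ψ`. -/
def lowblock (d : ℕ) (k₀ : EuclideanSpace ℝ (Fin d) → ℂ)
    (u : EuclideanSpace ℝ (Fin d) → ℂ) (x : EuclideanSpace ℝ (Fin d)) : ℂ :=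
  ∫ y, k₀ (x - y) * u y

/-- `ℓ^ρ` norm (in `ℝ≥0∞`) of a family indexed by `ℤ`, `ρ ∈ [1,∞]`. -/
def lqnorm (ρ : ℝ≥0∞) (a : ℤ → ℝ≥0∞) : ℝ≥0∞ :=
  if ρ = ⊤ then ⨆ j, a j else (∑' j, a j ^ ρ.toReal) ^ (1/ρ.toReal)

/-- Homogeneous Besov norm `‖u‖_{Ḃ^s_{p,ρ}}`. -/
def homBesov (d : ℕ) (k : EuclideanSpace ℝ (Fin d) → ℂ) (s : ℝ) (p ρ : ℝ≥0∞)
    (u : EuclideanSpace ℝ (Fin d) → ℂ) : ℝ≥0∞ :=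
  lqnorm ρ (fun j => ENNReal.ofReal ((2:ℝ) ^ ((j:ℝ)*s)) *
    eLpNorm (hblock d k j u) p volume)

/-- Inhomogeneous Besov norm `‖u‖_{B^s_{q,σ}}` (blocks `j ≥ -1`, with the
low-frequency block at `j = -1`). -/
def inhomBesov (d : ℕ) (k k₀ : EuclideanSpace ℝ (Fin d) → ℂ) (s : ℝ) (q σ : ℝ≥0∞)
    (u : EuclideanSpace ℝ (Fin d) → ℂ) : ℝ≥0∞ :=
  lqnorm σ (fun j => if j < -1 then 0 else
    ENNReal.ofReal ((2:ℝ) ^ ((j:ℝ)*s)) *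
      eLpNorm (if j = -1 then lowblock d k₀ u else hblock d k j u) q volume)

open FourierTransform in
/-- Injectivity of the Fourier transform on `L^1`. -/
theorem fourier_inj_aux {d : ℕ} {f : EuclideanSpace ℝ (Fin d) → ℂ} (hf : Integrable f)
    (h : ∀ ξ, 𝓕 f ξ = 0) : f =ᵐ[volume] 0 := by
  apply ae_eq_zero_of_integral_contDiff_smul_eq_zero hf.locallyIntegrable
  intro g hg hgs
  have hc : HasCompactSupport (fun x => (g x : ℂ)) := hgs.comp_left (g := fun x : ℝ => (x:ℂ)) (by simp)
  have hcd : ContDiff ℝ (⊤ : ℕ∞) (fun x => (g x : ℂ)) := Complex.ofRealCLM.contDiff.comp hg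
  let G : SchwartzMap (EuclideanSpace ℝ (Fin d)) ℂ := hc.toSchwartzMap hcd
  have hG : ∀ x, G x = (g x : ℂ) := fun x => rfl
  have key := VectorFourier.integral_fourierIntegral_smul_eq_flip (L := innerₗ (EuclideanSpace ℝ (Fin d)))
      Real.continuous_fourierChar continuous_inner hf (𝓕⁻ G).integrable (μ := volume) (ν := volume)
  have h1 : ∀ ξ, VectorFourier.fourierIntegral Real.fourierChar volume
      (innerₗ (EuclideanSpace ℝ (Fin d))) f ξ = 0 := h
  have h2 : ∀ x, VectorFourier.fourierIntegral Real.fourierChar volume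
      (innerₗ (EuclideanSpace ℝ (Fin d))).flip (⇑(𝓕⁻ G : SchwartzMap (EuclideanSpace ℝ (Fin d)) ℂ)) x = G x := by
    intro x
    have : 𝓕 (𝓕⁻ G) = G := FourierTransform.fourier_fourierInv_eq G
    have h3 := congrArg (fun F : SchwartzMap (EuclideanSpace ℝ (Fin d)) ℂ => F x) this
    simp only [SchwartzMap.fourier_coe] at h3
    rw [flip_innerₗ]
    exact h3
  simp only [h1, h2, hG, zero_smul, integral_zero] at key
  rw [key]
  congr 1
  ext x
  simp [mul_comm]

open FourierTransform in
theorem FT_eq_fourier (d : ℕ) (f : EuclideanSpace ℝ (Fin d) → ℂ) (ξ : EuclideanSpace ℝ (Fin d)) :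
    FT d f ξ = 𝓕 f ((2 * Real.pi)⁻¹ • ξ) := by
  rw [Real.fourier_eq', FT]
  congr 1
  ext x
  rw [inner_smul_right, smul_eq_mul]
  congr 2
  have : (Real.pi : ℂ) ≠ 0 := by exact_mod_cast Real.pi_ne_zero
  push_cast
  field_simp

open FourierTransform in
theorem FT_inj {d : ℕ} {f g : EuclideanSpace ℝ (Fin d) → ℂ} (hf : Integrable f) (hg : Integrable g)
    (h : ∀ ξ, FT d f ξ = FT d g ξ) : f =ᵐ[volume] g := by
  have := fourier_inj_aux (hf.sub hg) (fun ξ => by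
    have h1 := h ((2 * Real.pi) • ξ)
    rw [FT_eq_fourier, FT_eq_fourier, smul_smul, inv_mul_cancel₀ (by positivity), one_smul] at h1
    have h2 : 𝓕 (f - g) ξ = 𝓕 f ξ - 𝓕 g ξ := by
      simp only [Real.fourier_eq, Pi.sub_apply, smul_sub]
      rw [integral_sub]
      · exact (Real.fourierIntegral_convergent_iff ξ).2 hf
      · exact (Real.fourierIntegral_convergent_iff ξ).2 hg
    rw [h2, h1, sub_self])
  filter_upwards [this] with x hx
  simpa [sub_eq_zero] using hx

/-- There is a Schwartz function reproducing every `L^1` function with spectrum in the ball of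
radius 3. -/
theorem exists_reproducing (d : ℕ) : ∃ h : SchwartzMap (EuclideanSpace ℝ (Fin d)) ℂ,
    ∀ f : EuclideanSpace ℝ (Fin d) → ℂ, Integrable f → (∀ ξ, 3 < ‖ξ‖ → FT d f ξ = 0) →
      (fun x => ∫ z, h (x - z) * f z) =ᵐ[volume] f := by
  let b : ContDiffBump (0 : EuclideanSpace ℝ (Fin d)) := ⟨3, 4, by norm_num, by norm_num⟩
  have hc : HasCompactSupport (fun x => (b x : ℂ)) :=
    b.hasCompactSupport.comp_left (g := fun x : ℝ => (x:ℂ)) (by simp)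
  have hcd : ContDiff ℝ (⊤ : ℕ∞) (fun x => (b x : ℂ)) := Complex.ofRealCLM.contDiff.comp b.contDiff
  let G : SchwartzMap (EuclideanSpace ℝ (Fin d)) ℂ := hc.toSchwartzMap hcd
  have hG : ∀ x, G x = (b x : ℂ) := fun x => rfl
  let h := FourierTransform.fourierInv G
  refine ⟨h, fun f hf hsupp => ?_⟩
  have hh : ∀ x, FourierTransform.fourier (h : EuclideanSpace ℝ (Fin d) → ℂ) x = G x := by
    intro x
    have : FourierTransform.fourier (FourierTransform.fourierInv G) = G :=
      FourierTransform.fourier_fourierInv_eq G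
    have h3 := congrArg (fun F : SchwartzMap (EuclideanSpace ℝ (Fin d)) ℂ => F x) this
    simp only [SchwartzMap.fourier_coe] at h3
    exact h3
  have e : (fun x => ∫ z, h (x - z) * f z) =
      MeasureTheory.convolution f h (ContinuousLinearMap.mul ℂ ℂ) volume := by
    ext x
    simp [MeasureTheory.convolution, mul_comm]
  rw [e]
  refine FT_inj (hf.integrable_convolution _ h.integrable) hf fun ξ => ?_
  by_cases hξ : 3 < ‖ξ‖
  · have h1 := hsupp ξ hξ
    rw [h1]
    rw [FT_eq_fourier] at h1 ⊢
    rw [Real.fourier_mul_convolution_eq hf h.integrable, h1, zero_mul]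
  · rw [FT_eq_fourier, FT_eq_fourier, Real.fourier_mul_convolution_eq hf h.integrable, hh, hG]
    have : b ((2 * Real.pi)⁻¹ • ξ) = 1 := by
      apply b.one_of_mem_closedBall
      simp only [mem_closedBall_zero_iff, norm_smul, norm_inv, norm_mul, Real.norm_eq_abs]
      rw [abs_of_pos Real.pi_pos, abs_of_pos (by norm_num : (0:ℝ) < 2)]
      have h2 : (2 * Real.pi)⁻¹ ≤ 1 := inv_le_one_of_one_le₀ (by linarith [Real.pi_gt_three])
      have h3 : 0 ≤ (2 * Real.pi)⁻¹ := by positivity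
      show _ ≤ (3:ℝ)
      nlinarith [norm_nonneg ξ]
    rw [this]; simp

theorem lowblock_aesm {d : ℕ} {f v : EuclideanSpace ℝ (Fin d) → ℂ} (hf : Integrable f)
    (hv : AEStronglyMeasurable v volume) : AEStronglyMeasurable (lowblock d f v) volume := by
  have h1 : AEStronglyMeasurable
      (fun a : EuclideanSpace ℝ (Fin d) × EuclideanSpace ℝ (Fin d) => f (a.1 - a.2) * v a.2)
      (volume.prod volume) :=
    (hf.1.comp_quasiMeasurePreserving (quasiMeasurePreserving_sub volume volume)).mul
      (hv.comp_quasiMeasurePreserving Measure.quasiMeasurePreserving_snd)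
  exact h1.integral_prod_right'

theorem holder_aux {d : ℕ} {r r' : ℝ≥0∞} [ENNReal.HolderTriple r' r 1]
    (h : SchwartzMap (EuclideanSpace ℝ (Fin d)) ℂ) {u : EuclideanSpace ℝ (Fin d) → ℂ}
    (hu : AEStronglyMeasurable u volume) (w : EuclideanSpace ℝ (Fin d)) :
    ∫⁻ y, ‖h (w - y)‖ₑ * ‖u y‖ₑ ≤ eLpNorm h r' volume * eLpNorm u r volume := by
  have h1 : eLpNorm (fun y => h (w - y)) r' volume = eLpNorm h r' volume :=
    eLpNorm_comp_measurePreserving h.continuous.aestronglyMeasurable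
      (Measure.measurePreserving_sub_left volume w)
  rw [← h1]
  have h2 := eLpNorm_smul_le_mul_eLpNorm (μ := volume) (p := r') (q := r) (r := 1) hu
    (φ := fun y => h (w - y)) (by
      apply Continuous.aestronglyMeasurable; fun_prop)
  rw [eLpNorm_one_eq_lintegral_enorm] at h2
  simpa [enorm_smul] using h2

theorem exists_conj {r : ℝ≥0∞} (hr : 1 ≤ r) : ∃ r' : ℝ≥0∞, ENNReal.HolderTriple r' r 1 := by
  refine ⟨r.conjExponent, ?_⟩
  have := ENNReal.HolderConjugate.conjExponent hr
  exact ENNReal.HolderTriple.symm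

section
variable {d : ℕ} (h : SchwartzMap (EuclideanSpace ℝ (Fin d)) ℂ)
    {f u : EuclideanSpace ℝ (Fin d) → ℂ}

theorem triple_aesm (hf : Integrable f) (hu : AEStronglyMeasurable u volume)
    (x : EuclideanSpace ℝ (Fin d)) :
    AEStronglyMeasurable
      (fun a : EuclideanSpace ℝ (Fin d) × EuclideanSpace ℝ (Fin d) =>
        h (x - a.1) * (f (a.1 - a.2) * u a.2)) (volume.prod volume) := by
  refine AEStronglyMeasurable.mul ?_ ((hf.1.comp_quasiMeasurePreserving
    (quasiMeasurePreserving_sub volume volume)).mul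
      (hu.comp_quasiMeasurePreserving Measure.quasiMeasurePreserving_snd))
  apply Continuous.aestronglyMeasurable
  fun_prop

theorem triple_lintegral {r r' : ℝ≥0∞} [ENNReal.HolderTriple r' r 1]
    (hf : Integrable f) (hu : AEStronglyMeasurable u volume)
    (x : EuclideanSpace ℝ (Fin d)) :
    ∫⁻ y, ∫⁻ z, ‖h (x - z) * (f (z - y) * u y)‖ₑ ≤
      eLpNorm f 1 volume * (eLpNorm h r' volume * eLpNorm u r volume) := by
  have e1 : ∀ y, ∫⁻ z, ‖h (x - z) * (f (z - y) * u y)‖ₑ =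
      ∫⁻ w, ‖f (x - w)‖ₑ * (‖h (w - y)‖ₑ * ‖u y‖ₑ) := by
    intro y
    rw [← lintegral_sub_left_eq_self _ (x + y)]
    congr 1
    ext w
    rw [show x - (x + y - w) = w - y by abel, show x + y - w - y = x - w by abel]
    simp only [enorm_mul]
    ring
  simp_rw [e1]
  rw [lintegral_lintegral_swap]
  · calc ∫⁻ w, ∫⁻ y, ‖f (x - w)‖ₑ * (‖h (w - y)‖ₑ * ‖u y‖ₑ)
        ≤ ∫⁻ w, ‖f (x - w)‖ₑ * (eLpNorm h r' volume * eLpNorm u r volume) := by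
          apply lintegral_mono
          intro w
          simp only
          rw [lintegral_const_mul'' _ (by
            apply AEMeasurable.mul _ hu.enorm
            exact (show Continuous fun y => ‖h (w - y)‖ₑ by fun_prop).measurable.aemeasurable)]
          gcongr
          exact holder_aux h hu w
      _ = _ := by
          have hm : AEMeasurable (fun w => ‖f (x - w)‖ₑ) volume :=
            (hf.1.comp_quasiMeasurePreserving
              (Measure.measurePreserving_sub_left volume x).quasiMeasurePreserving).enorm
          rw [lintegral_mul_const'' _ hm,
            lintegral_sub_left_eq_self (fun w => ‖f w‖ₑ) x, eLpNorm_one_eq_lintegral_enorm]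
  · have m1 : AEMeasurable (fun a : EuclideanSpace ℝ (Fin d) × EuclideanSpace ℝ (Fin d) =>
        ‖f (x - a.2)‖ₑ) (volume.prod volume) :=
      ((hf.1.comp_quasiMeasurePreserving
        (Measure.measurePreserving_sub_left volume x).quasiMeasurePreserving).comp_quasiMeasurePreserving
            Measure.quasiMeasurePreserving_snd).enorm
    have m2 : AEMeasurable (fun a : EuclideanSpace ℝ (Fin d) × EuclideanSpace ℝ (Fin d) =>
        ‖h (a.2 - a.1)‖ₑ) (volume.prod volume) :=
      (show Continuous fun a : EuclideanSpace ℝ (Fin d) × EuclideanSpace ℝ (Fin d) =>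
        ‖h (a.2 - a.1)‖ₑ by fun_prop).measurable.aemeasurable
    have m3 : AEMeasurable (fun a : EuclideanSpace ℝ (Fin d) × EuclideanSpace ℝ (Fin d) =>
        ‖u a.1‖ₑ) (volume.prod volume) :=
      (hu.comp_quasiMeasurePreserving Measure.quasiMeasurePreserving_fst).enorm
    exact m1.mul (m2.mul m3)

theorem triple_integrable {r : ℝ≥0∞} (hr : 1 ≤ r)
    (hf : Integrable f) (hu : MemLp u r volume) (x : EuclideanSpace ℝ (Fin d)) :
    Integrable (fun a : EuclideanSpace ℝ (Fin d) × EuclideanSpace ℝ (Fin d) =>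
        h (x - a.1) * (f (a.1 - a.2) * u a.2)) (volume.prod volume) := by
  obtain ⟨r', hr'⟩ := exists_conj hr
  refine ⟨triple_aesm h hf hu.1 x, ?_⟩
  have hm : AEMeasurable (fun a : EuclideanSpace ℝ (Fin d) × EuclideanSpace ℝ (Fin d) =>
        ‖h (x - a.1) * (f (a.1 - a.2) * u a.2)‖ₑ) (volume.prod volume) :=
    (triple_aesm h hf hu.1 x).enorm
  rw [HasFiniteIntegral, lintegral_prod_symm _ hm]
  have key := triple_lintegral (r := r) (r' := r') h hf hu.1 x
  have h1 : eLpNorm f 1 volume < ⊤ := (memLp_one_iff_integrable.2 hf).2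
  have h2 : eLpNorm h r' volume < ⊤ := (h.memLp r' volume).2
  exact lt_of_le_of_lt key (ENNReal.mul_lt_top h1 (ENNReal.mul_lt_top h2 hu.2))

theorem inner_eq (hrep : (fun x => ∫ z, h (x - z) * f z) =ᵐ[volume] f)
    (x : EuclideanSpace ℝ (Fin d)) :
    (fun y => ∫ z, h (x - z) * (f (z - y) * u y)) =ᵐ[volume] fun y => f (x - y) * u y := by
  have h1 := (Measure.measurePreserving_sub_left volume x).quasiMeasurePreserving.ae_eq_comp hrep
  filter_upwards [h1] with y hy
  simp only [Function.comp] at hy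
  rw [← hy, ← integral_mul_const]
  rw [← integral_add_right_eq_self _ y]
  congr 1
  ext z
  rw [show x - (z + y) = x - y - z by abel, add_sub_cancel_right]
  ring

/-- `f(x-·)u` is integrable. -/
theorem conv_integrable {r : ℝ≥0∞} (hr : 1 ≤ r)
    (hf : Integrable f) (hrep : (fun x => ∫ z, h (x - z) * f z) =ᵐ[volume] f)
    (hu : MemLp u r volume) (x : EuclideanSpace ℝ (Fin d)) :
    Integrable (fun y => f (x - y) * u y) :=
  (triple_integrable h hr hf hu x).integral_prod_right.congr (inner_eq h hrep x)

theorem conv_repr {r : ℝ≥0∞} (hr : 1 ≤ r)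
    (hf : Integrable f) (hrep : (fun x => ∫ z, h (x - z) * f z) =ᵐ[volume] f)
    (hu : MemLp u r volume) (x : EuclideanSpace ℝ (Fin d)) :
    lowblock d f u x = ∫ z, h (x - z) * lowblock d f u z := by
  rw [lowblock, ← integral_congr_ae (inner_eq h hrep x),
    ← integral_integral_swap (triple_integrable h hr hf hu x)]
  congr 1
  ext z
  rw [integral_const_mul, lowblock]

theorem conv_bound1 {r r' : ℝ≥0∞} [ENNReal.HolderTriple r' r 1]
    (hf : Integrable f) (hrep : (fun x => ∫ z, h (x - z) * f z) =ᵐ[volume] f)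
    (hu : MemLp u r volume) (x : EuclideanSpace ℝ (Fin d)) :
    ‖lowblock d f u x‖ₑ ≤ eLpNorm f 1 volume * (eLpNorm h r' volume * eLpNorm u r volume) := by
  rw [lowblock, ← integral_congr_ae (inner_eq h hrep x)]
  refine (enorm_integral_le_lintegral_enorm _).trans (le_trans ?_ (triple_lintegral h hf hu.1 x))
  exact lintegral_mono fun y => enorm_integral_le_lintegral_enorm _

theorem conv_bound2 {r p p' : ℝ≥0∞} (hr : 1 ≤ r) [ENNReal.HolderTriple p' p 1]
    (hf : Integrable f) (hrep : (fun x => ∫ z, h (x - z) * f z) =ᵐ[volume] f)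
    (hu : MemLp u r volume) (x : EuclideanSpace ℝ (Fin d)) :
    ‖lowblock d f u x‖ₑ ≤ eLpNorm h p' volume * eLpNorm (lowblock d f u) p volume := by
  rw [conv_repr h hr hf hrep hu x]
  refine (enorm_integral_le_lintegral_enorm _).trans ?_
  simp_rw [enorm_mul]
  exact holder_aux h (lowblock_aesm hf hu.1) x
end

theorem scale_eLpNorm {d : ℕ} (g : EuclideanSpace ℝ (Fin d) → ℂ) {c : ℝ} (hc : 0 < c) (r : ℝ≥0∞) :
    eLpNorm (fun x => g (c • x)) r volume =
      ENNReal.ofReal (c ^ (-((d:ℝ) / r.toReal))) * eLpNorm g r volume := by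
  have hme : MeasurableEmbedding (fun x : EuclideanSpace ℝ (Fin d) => c • x) :=
    (Homeomorph.smulOfNeZero c hc.ne').measurableEmbedding
  have h1 := hme.eLpNorm_map_measure (g := g) (p := r) (μ := volume)
  have h2 : Measure.map (fun x : EuclideanSpace ℝ (Fin d) => c • x) volume =
      ENNReal.ofReal |(c ^ Module.finrank ℝ (EuclideanSpace ℝ (Fin d)))⁻¹| • volume :=
    Measure.map_addHaar_smul volume hc.ne'
  rw [h2] at h1
  have hpos : 0 < (c ^ d)⁻¹ := by positivity
  rw [finrank_euclideanSpace_fin, abs_of_pos hpos,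
    eLpNorm_smul_measure_of_ne_zero (by simpa using pow_pos hc d)] at h1
  change eLpNorm (g ∘ fun x => c • x) r volume = _
  rw [← h1, smul_eq_mul, ENNReal.ofReal_rpow_of_pos hpos]
  congr 2
  rw [one_div, ENNReal.toReal_inv, ← Real.rpow_natCast, ← Real.rpow_neg hc.le, ← Real.rpow_mul hc.le]
  congr 1
  ring

section
variable {d : ℕ} {f u : EuclideanSpace ℝ (Fin d) → ℂ}

theorem hblock_eq (f u : EuclideanSpace ℝ (Fin d) → ℂ) (j : ℤ) (x : EuclideanSpace ℝ (Fin d)) :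
    hblock d f j u x = lowblock d f (fun z => u (((2:ℝ)^j)⁻¹ • z)) ((2:ℝ)^j • x) := by
  have hc : (0:ℝ) < (2:ℝ)^j := by positivity
  set c := (2:ℝ)^j with hcdef
  have h1 := Measure.integral_comp_smul (μ := volume)
    (fun z : EuclideanSpace ℝ (Fin d) => f (c • x - z) * u (c⁻¹ • z)) c
  rw [finrank_euclideanSpace_fin, abs_of_pos (by positivity)] at h1
  have h2 : lowblock d f (fun z => u (c⁻¹ • z)) (c • x) =
      (c^d) • ∫ y, f (c • x - c • y) * u (c⁻¹ • c • y) := by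
    rw [h1, smul_smul, mul_inv_cancel₀ (by positivity), one_smul, lowblock]
  rw [h2, hblock, ← integral_smul]
  congr 1
  ext y
  rw [inv_smul_smul₀ hc.ne', smul_sub, Complex.real_smul, mul_assoc]

theorem lowblock_eq_hblock (f u : EuclideanSpace ℝ (Fin d) → ℂ) :
    lowblock d f u = hblock d f 0 u := by
  ext x
  rw [hblock_eq]; simp

theorem memLp_scale {r : ℝ≥0∞} (hu : MemLp u r volume) {c : ℝ} (hc : 0 < c) :
    MemLp (fun z => u (c • z)) r volume := by
  refine ⟨?_, ?_⟩
  · exact hu.1.comp_quasiMeasurePreserving (Measure.quasiMeasurePreserving_smul volume hc.ne')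
  · rw [scale_eLpNorm u hc]
    exact ENNReal.mul_lt_top ENNReal.ofReal_lt_top hu.2

theorem aesm_scale (hu : AEStronglyMeasurable u volume) {c : ℝ} (hc : 0 < c) :
    AEStronglyMeasurable (fun z => u (c • z)) volume := 
  hu.comp_quasiMeasurePreserving (Measure.quasiMeasurePreserving_smul volume hc.ne')

theorem hblock_aesm (hf : Integrable f) (hu : AEStronglyMeasurable u volume) (j : ℤ) :
    AEStronglyMeasurable (hblock d f j u) volume := by
  have : hblock d f j u = fun x => lowblock d f (fun z => u (((2:ℝ)^j)⁻¹ • z)) ((2:ℝ)^j • x) := by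
    ext x; exact hblock_eq f u j x
  rw [this]
  exact aesm_scale (lowblock_aesm hf (aesm_scale hu (by positivity))) (by positivity)

theorem two_pow_rpow (j : ℤ) (a : ℝ) : ((2:ℝ)^j) ^ a = (2:ℝ) ^ ((j:ℝ) * a) := by
  rw [← Real.rpow_intCast, ← Real.rpow_mul (by norm_num)]

variable (h : SchwartzMap (EuclideanSpace ℝ (Fin d)) ℂ)

theorem hblock_bound1 {r r' : ℝ≥0∞} [ENNReal.HolderTriple r' r 1]
    (hf : Integrable f) (hrep : (fun x => ∫ z, h (x - z) * f z) =ᵐ[volume] f)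
    (hu : MemLp u r volume) (j : ℤ) (x : EuclideanSpace ℝ (Fin d)) :
    ‖hblock d f j u x‖ₑ ≤ eLpNorm f 1 volume * (eLpNorm h r' volume *
      (ENNReal.ofReal ((2:ℝ) ^ ((j:ℝ) * ((d:ℝ) / r.toReal))) * eLpNorm u r volume)) := by
  have hc : (0:ℝ) < ((2:ℝ)^j)⁻¹ := by positivity
  have h1 := conv_bound1 (r := r) (r' := r') h hf hrep (memLp_scale hu hc) ((2:ℝ)^j • x)
  rw [scale_eLpNorm u hc, ← hblock_eq, ← zpow_neg, two_pow_rpow] at h1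
  convert! h1 using 6
  push_cast; ring_nf

theorem hblock_bound2 {r p p' : ℝ≥0∞} (hr : 1 ≤ r) [ENNReal.HolderTriple p' p 1]
    (hf : Integrable f) (hrep : (fun x => ∫ z, h (x - z) * f z) =ᵐ[volume] f)
    (hu : MemLp u r volume) (j : ℤ) (x : EuclideanSpace ℝ (Fin d)) :
    ‖hblock d f j u x‖ₑ ≤ eLpNorm h p' volume *
      (ENNReal.ofReal ((2:ℝ) ^ ((j:ℝ) * ((d:ℝ) / p.toReal))) *
        eLpNorm (hblock d f j u) p volume) := by
  have hc : (0:ℝ) < ((2:ℝ)^j)⁻¹ := by positivity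
  have hc' : (0:ℝ) < (2:ℝ)^j := by positivity
  have h1 := conv_bound2 (p := p) (p' := p') h hr hf hrep (memLp_scale hu hc) ((2:ℝ)^j • x)
  have h2 : lowblock d f (fun z => u (((2:ℝ)^j)⁻¹ • z)) =
      fun x => hblock d f j u (((2:ℝ)^j)⁻¹ • x) := by
    ext y
    rw [hblock_eq, smul_inv_smul₀ hc'.ne']
  rw [← hblock_eq, h2, scale_eLpNorm _ hc, ← zpow_neg, two_pow_rpow] at h1
  convert! h1 using 5
  push_cast; ring_nf

theorem hblock_integrable {r : ℝ≥0∞} (hr : 1 ≤ r)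
    (hf : Integrable f) (hrep : (fun x => ∫ z, h (x - z) * f z) =ᵐ[volume] f)
    (hu : MemLp u r volume) (j : ℤ) (x : EuclideanSpace ℝ (Fin d)) :
    Integrable (fun y => (((((2:ℝ)^j)^d : ℝ)) : ℂ) * f ((2:ℝ)^j • (x - y)) * u y) := by
  have hc : (0:ℝ) < ((2:ℝ)^j)⁻¹ := by positivity
  have hc' : (0:ℝ) < (2:ℝ)^j := by positivity
  have h1 := conv_integrable h hr hf hrep (memLp_scale hu hc) ((2:ℝ)^j • x)
  have h2 := (h1.comp_smul hc'.ne').const_mul (((((2:ℝ)^j)^d : ℝ)) : ℂ)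
  refine h2.congr (Filter.Eventually.of_forall fun y => ?_)
  simp only
  rw [inv_smul_smul₀ hc'.ne', smul_sub, mul_assoc]

theorem hblock_telescope {r : ℝ≥0∞} (hr : 1 ≤ r) {k k₀ : EuclideanSpace ℝ (Fin d) → ℂ}
    (hk₀ : Integrable k₀) (hrep : (fun x => ∫ z, h (x - z) * k₀ z) =ᵐ[volume] k₀)
    (hkk : ∀ᵐ x, k x = (2:ℂ)^d * k₀ ((2:ℝ) • x) - k₀ x)
    (hu : MemLp u r volume) (j : ℤ) (x : EuclideanSpace ℝ (Fin d)) :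
    hblock d k₀ (j+1) u x = hblock d k₀ j u x + hblock d k j u x := by
  have hc' : (0:ℝ) < (2:ℝ)^j := by positivity
  have q1 : Measure.QuasiMeasurePreserving (fun y : EuclideanSpace ℝ (Fin d) => (2:ℝ)^j • (x - y))
      volume volume :=
    (Measure.quasiMeasurePreserving_smul volume hc'.ne').comp
      (Measure.measurePreserving_sub_left volume x).quasiMeasurePreserving
  have h1 : ∀ᵐ y, k ((2:ℝ)^j • (x - y)) =
      (2:ℂ)^d * k₀ ((2:ℝ) • (2:ℝ)^j • (x - y)) - k₀ ((2:ℝ)^j • (x - y)) := q1.ae hkk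
  have h2 : hblock d k j u x = ∫ y, ((((((2:ℝ)^(j+1))^d : ℝ)) : ℂ) * k₀ ((2:ℝ)^(j+1) • (x - y)) * u y
      - (((((2:ℝ)^j)^d : ℝ)) : ℂ) * k₀ ((2:ℝ)^j • (x - y)) * u y) := by
    rw [hblock]
    apply integral_congr_ae
    filter_upwards [h1] with y hy
    rw [hy, smul_smul, zpow_add_one₀ (by norm_num), mul_comm (2:ℝ) ((2:ℝ)^j)]
    push_cast
    ring
  rw [h2, integral_sub (hblock_integrable h hr hk₀ hrep hu (j+1) x)
    (hblock_integrable h hr hk₀ hrep hu j x), hblock, hblock]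
  ring

theorem hblock_telescope_sum {r : ℝ≥0∞} (hr : 1 ≤ r) {k k₀ : EuclideanSpace ℝ (Fin d) → ℂ}
    (hk₀ : Integrable k₀) (hrep : (fun x => ∫ z, h (x - z) * k₀ z) =ᵐ[volume] k₀)
    (hkk : ∀ᵐ x, k x = (2:ℂ)^d * k₀ ((2:ℝ) • x) - k₀ x)
    (hu : MemLp u r volume) (N : ℕ) (x : EuclideanSpace ℝ (Fin d)) :
    lowblock d k₀ u x = hblock d k₀ (-(N:ℤ)) u x + 
      ∑ i ∈ Finset.range N, hblock d k (-(i:ℤ) - 1) u x := by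
  induction N with
  | zero => simp [lowblock_eq_hblock]
  | succ n ih =>
    rw [ih, Finset.sum_range_succ]
    have := hblock_telescope h hr hk₀ hrep hkk hu (-(n:ℤ) - 1) x
    rw [show -(n:ℤ) - 1 + 1 = -(n:ℤ) by ring] at this
    rw [this]
    push_cast
    rw [show -((n:ℤ) + 1) = -(n:ℤ) - 1 by ring]
    ring
end

section
variable {d : ℕ} {φ : EuclideanSpace ℝ (Fin d) → ℝ}

theorem phi_zero_of_large (hφ_supp : Function.support φ ⊆
      {ξ : EuclideanSpace ℝ (Fin d) | 3/4 ≤ ‖ξ‖ ∧ ‖ξ‖ ≤ 8/3}) {ξ : EuclideanSpace ℝ (Fin d)}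
      (h : 8/3 < ‖ξ‖) : φ ξ = 0 := by
  by_contra hne
  exact absurd (hφ_supp hne).2 (not_le.2 h)

theorem phi_zero_of_small (hφ_supp : Function.support φ ⊆
      {ξ : EuclideanSpace ℝ (Fin d) | 3/4 ≤ ‖ξ‖ ∧ ‖ξ‖ ≤ 8/3}) {ξ : EuclideanSpace ℝ (Fin d)}
      (h : ‖ξ‖ < 3/4) : φ ξ = 0 := by
  by_contra hne
  exact absurd (hφ_supp hne).1 (not_le.2 h)

theorem phi_summable (hφ_supp : Function.support φ ⊆
      {ξ : EuclideanSpace ℝ (Fin d) | 3/4 ≤ ‖ξ‖ ∧ ‖ξ‖ ≤ 8/3}) (ξ : EuclideanSpace ℝ (Fin d)) :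
    Summable (fun j : ℕ => φ ((2:ℝ)^(-(j:ℤ)) • ξ)) := by
  have ht : Filter.Tendsto (fun j : ℕ => (1/2:ℝ)^j * ‖ξ‖) Filter.atTop (nhds (0 * ‖ξ‖)) :=
    (tendsto_pow_atTop_nhds_zero_of_lt_one (by norm_num) (by norm_num)).mul_const _
  rw [zero_mul] at ht
  have hev := ht.eventually (gt_mem_nhds (show (0:ℝ) < 3/4 by norm_num))
  obtain ⟨n, hn⟩ := Filter.eventually_atTop.1 hev
  apply summable_of_ne_finset_zero (s := Finset.range n)
  intro j hj
  apply phi_zero_of_small hφ_supp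
  have := hn j (by simpa using hj)
  rw [norm_smul, norm_zpow, Real.norm_eq_abs, abs_of_pos (by norm_num : (0:ℝ) < 2), zpow_neg,
    zpow_natCast, ← inv_pow]
  simpa using this

theorem psi_zero_of_large (hφ_supp : Function.support φ ⊆
      {ξ : EuclideanSpace ℝ (Fin d) | 3/4 ≤ ‖ξ‖ ∧ ‖ξ‖ ≤ 8/3})
    (hφ_sum : ∀ ξ : EuclideanSpace ℝ (Fin d), ξ ≠ 0 →
      (∑' j : ℤ, φ ((2:ℝ)^(-j) • ξ)) = 1) {ξ : EuclideanSpace ℝ (Fin d)} (h : 3 < ‖ξ‖) :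
    (1 - ∑' j : ℕ, φ ((2:ℝ)^(-(j:ℤ)) • ξ) : ℝ) = 0 := by
  have h0 : ξ ≠ 0 := by
    rintro rfl
    norm_num at h
  rw [← hφ_sum ξ h0, sub_eq_zero]
  symm
  refine (Function.Injective.tsum_eq (g := fun j : ℕ => (j:ℤ)) Nat.cast_injective
    (f := fun j : ℤ => φ ((2:ℝ)^(-j) • ξ)) ?_)
  intro j hj
  by_contra hneg
  apply hj
  have hj0 : j < 0 := by
    by_contra hc
    exact hneg ⟨j.toNat, by simp; omega⟩
  apply phi_zero_of_large hφ_supp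
  rw [norm_smul, norm_zpow, Real.norm_eq_abs, abs_of_pos (by norm_num : (0:ℝ) < 2)]
  have : (1:ℝ) ≤ (2:ℝ)^(-j) := one_le_zpow₀ (by norm_num) (by omega)
  nlinarith

theorem FT_dilate (k₀ : EuclideanSpace ℝ (Fin d) → ℂ) (ξ : EuclideanSpace ℝ (Fin d)) :
    FT d (fun x => (2:ℂ)^d * k₀ ((2:ℝ) • x)) ξ = FT d k₀ ((2:ℝ)⁻¹ • ξ) := by
  have h1 := Measure.integral_comp_smul (μ := volume)
    (fun z : EuclideanSpace ℝ (Fin d) =>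
      Complex.exp (-Complex.I * ((⟪z, (2:ℝ)⁻¹ • ξ⟫ : ℝ) : ℂ)) * k₀ z) 2
  rw [finrank_euclideanSpace_fin, abs_of_pos (by positivity)] at h1
  have h2 : FT d k₀ ((2:ℝ)⁻¹ • ξ) = ((2:ℝ)^d) • ∫ x,
      Complex.exp (-Complex.I * ((⟪(2:ℝ) • x, (2:ℝ)⁻¹ • ξ⟫ : ℝ) : ℂ)) * k₀ ((2:ℝ) • x) := by
    rw [h1, smul_smul, mul_inv_cancel₀ (by positivity), one_smul, FT]
  rw [h2, FT, ← integral_smul]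
  congr 1
  ext x
  rw [inner_smul_left, inner_smul_right, Complex.real_smul]
  simp
  ring

theorem kernel_relation (hφ_supp : Function.support φ ⊆
      {ξ : EuclideanSpace ℝ (Fin d) | 3/4 ≤ ‖ξ‖ ∧ ‖ξ‖ ≤ 8/3})
    {k k₀ : EuclideanSpace ℝ (Fin d) → ℂ}
    (hk_int : Integrable k) (hk₀_int : Integrable k₀)
    (hk : ∀ ξ, FT d k ξ = ((φ ξ : ℝ) : ℂ))
    (hk₀ : ∀ ξ, FT d k₀ ξ =
      ((1 - ∑' j : ℕ, φ ((2:ℝ)^(-(j:ℤ)) • ξ) : ℝ) : ℂ)) :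
    ∀ᵐ x, k x = (2:ℂ)^d * k₀ ((2:ℝ) • x) - k₀ x := by
  have hi : Integrable (fun x => (2:ℂ)^d * k₀ ((2:ℝ) • x)) :=
    (hk₀_int.comp_smul (by norm_num)).const_mul _
  refine FT_inj hk_int (hi.sub hk₀_int) fun ξ => ?_
  have hsub : FT d (fun x => (2:ℂ)^d * k₀ ((2:ℝ) • x) - k₀ x) ξ =
      FT d (fun x => (2:ℂ)^d * k₀ ((2:ℝ) • x)) ξ - FT d k₀ ξ := by
    have hfi : ∀ g : EuclideanSpace ℝ (Fin d) → ℂ, Integrable g →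
        Integrable (fun x => Complex.exp (-Complex.I * ((⟪x, ξ⟫ : ℝ) : ℂ)) * g x) := by
      intro g hg
      refine hg.bdd_mul (c := 1) (Continuous.aestronglyMeasurable (by fun_prop))
        (Filter.Eventually.of_forall fun x => ?_)
      rw [show -Complex.I * ((⟪x, ξ⟫ : ℝ) : ℂ) = ((-⟪x, ξ⟫ : ℝ) : ℂ) * Complex.I by
        push_cast; ring, Complex.norm_exp_ofReal_mul_I]
    simp only [FT, mul_sub]
    exact integral_sub (hfi _ hi) (hfi _ hk₀_int)
  change _ = FT d (fun x => (2:ℂ)^d * k₀ ((2:ℝ) • x) - k₀ x) ξ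
  rw [hsub, FT_dilate, hk, hk₀, hk₀, ← Complex.ofReal_sub]
  congr 1
  have h1 := (phi_summable hφ_supp ξ).tsum_eq_zero_add
  have h2 : ∀ j : ℕ, φ ((2:ℝ)^(-(j:ℤ)) • (2:ℝ)⁻¹ • ξ) = φ ((2:ℝ)^(-((j+1 : ℕ):ℤ)) • ξ) := by
    intro j
    rw [smul_smul]
    congr 2
    push_cast
    rw [neg_add, zpow_add₀ (by norm_num)]
    simp
  simp_rw [h2]
  simp only [Nat.cast_zero, neg_zero, zpow_zero, one_smul] at h1
  linarith
end

theorem eLpNorm_tsum_bound {α : Type*} [MeasurableSpace α] {μ : Measure α} {q : ℝ≥0∞} (hq1 : 1 ≤ q)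
    (hq2 : q ≠ ⊤) {u : α → ℂ} {g : ℕ → α → ℂ} (hg : ∀ n, AEStronglyMeasurable (g n) μ)
    (hb : ∀ x, ‖u x‖ₑ ≤ ∑' n, ‖g n x‖ₑ) : eLpNorm u q μ ≤ ∑' n, eLpNorm (g n) q μ := by
  have hq0 : q ≠ 0 := (zero_lt_one.trans_le hq1).ne'
  have hqr : 0 < q.toReal := ENNReal.toReal_pos hq0 hq2
  let S : ℕ → α → ℝ≥0∞ := fun n => ∑ i ∈ Finset.range n, fun x => ‖g i x‖ₑ
  have hSx : ∀ n x, S n x = ∑ i ∈ Finset.range n, ‖g i x‖ₑ := fun n x => by simp [S]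
  have hS : ∀ n, eLpNorm (S n) q μ ≤ ∑' n, eLpNorm (g n) q μ := by
    intro n
    refine (eLpNorm_sum_le (fun i _ => (hg i).enorm.aestronglyMeasurable) hq1).trans ?_
    refine le_trans (le_of_eq ?_) (ENNReal.sum_le_tsum (Finset.range n))
    refine Finset.sum_congr rfl fun i _ => ?_
    exact eLpNorm_enorm (g i)
  have hSm : ∀ n, AEMeasurable (S n) μ := fun n =>
    Finset.aemeasurable_sum _ fun i _ => (hg i).enorm
  rw [eLpNorm_eq_lintegral_rpow_enorm_toReal hq0 hq2, one_div, ENNReal.rpow_inv_le_iff hqr]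
  have hmono : ∀ x, Monotone fun n => S n x := by
    intro x m n hmn
    simp only [hSx]
    exact Finset.sum_le_sum_of_subset (Finset.range_mono hmn)
  calc ∫⁻ x, ‖u x‖ₑ ^ q.toReal ∂μ ≤ ∫⁻ x, ⨆ n, S n x ^ q.toReal ∂μ := by
        apply lintegral_mono
        intro x
        have h1 : ‖u x‖ₑ ≤ ⨆ n, S n x := by
          refine (hb x).trans (le_of_eq ?_)
          simp only [hSx]
          exact ENNReal.tsum_eq_iSup_nat
        have h2 : (⨆ n, S n x) ^ q.toReal = ⨆ n, S n x ^ q.toReal :=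
          (ENNReal.orderIsoRpow q.toReal hqr).map_iSup _
        simp only
        rw [← h2]
        gcongr
    _ = ⨆ n, ∫⁻ x, S n x ^ q.toReal ∂μ := by
        apply lintegral_iSup'
        · intro n
          exact (hSm n).pow_const _
        · refine Filter.Eventually.of_forall fun x m n hmn => ?_
          exact ENNReal.rpow_le_rpow (hmono x hmn) hqr.le
    _ ≤ _ := by
        apply iSup_le
        intro n
        have := hS n
        rw [eLpNorm_eq_lintegral_rpow_enorm_toReal hq0 hq2, one_div,
          ENNReal.rpow_inv_le_iff hqr] at this
        simpa using this

theorem le_lqnorm {σ : ℝ≥0∞} (hσ : 1 ≤ σ) (a : ℤ → ℝ≥0∞) (j : ℤ) : a j ≤ lqnorm σ a := by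
  unfold lqnorm
  split_ifs with h
  · exact le_iSup a j
  · have hr : 0 < σ.toReal := ENNReal.toReal_pos (zero_lt_one.trans_le hσ).ne' h
    rw [one_div, ENNReal.le_rpow_inv_iff hr]
    exact ENNReal.le_tsum j

theorem sum_le_lqnorm {ρ : ℝ≥0∞} (hρ : 1 ≤ ρ) (a : ℤ → ℝ≥0∞) (N : ℕ) (hN : 0 < N) (g : ℕ → ℤ)
    (hg : Function.Injective g) :
    ∑ i ∈ Finset.range N, a (g i) ≤
      ENNReal.ofReal ((N:ℝ) ^ (1 - 1/ρ.toReal)) * lqnorm ρ a := by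
  by_cases h : ρ = ⊤
  · subst h
    simp only [ENNReal.toReal_top, div_zero, sub_zero, Real.rpow_one, ENNReal.ofReal_natCast]
    refine (Finset.sum_le_card_nsmul _ _ (lqnorm ⊤ a) fun i _ => le_lqnorm le_top a _).trans ?_
    simp
  · have hr1 : 1 ≤ ρ.toReal := by
      rw [← ENNReal.toReal_one]
      exact ENNReal.toReal_mono h hρ
    have hr : 0 < ρ.toReal := by linarith
    have key := ENNReal.rpow_sum_le_const_mul_sum_rpow (Finset.range N) (fun i => a (g i)) hr1
    have h2 : ∑ i ∈ Finset.range N, a (g i) ^ ρ.toReal ≤ ∑' j, a j ^ ρ.toReal := by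
      rw [← Finset.sum_image (f := fun j => a j ^ ρ.toReal) (g := g) (fun x _ y _ hxy => hg hxy)]
      exact ENNReal.sum_le_tsum _
    have h3 := ENNReal.rpow_le_rpow (key.trans (mul_le_mul_right h2 _))
      (show 0 ≤ 1/ρ.toReal by positivity)
    rw [← ENNReal.rpow_mul, mul_one_div_cancel hr.ne', ENNReal.rpow_one,
      ENNReal.mul_rpow_of_nonneg _ _ (by positivity)] at h3
    refine h3.trans (le_of_eq ?_)
    unfold lqnorm
    rw [if_neg h, Finset.card_range, ← ENNReal.rpow_mul,
      ← ENNReal.ofReal_rpow_of_pos (by exact_mod_cast hN), ENNReal.ofReal_natCast]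
    congr 2
    field_simp

theorem geom_ne_top {ε : ℝ} (hε : 0 < ε) :
    ∑' i : ℕ, ENNReal.ofReal ((2:ℝ) ^ (-((i:ℝ) * ε))) ≠ ⊤ := by
  have e : ∀ i : ℕ, ENNReal.ofReal ((2:ℝ) ^ (-((i:ℝ) * ε))) =
      ENNReal.ofReal ((2:ℝ) ^ (-ε)) ^ i := by
    intro i
    rw [← ENNReal.ofReal_pow (by positivity), ← Real.rpow_natCast, ← Real.rpow_mul (by norm_num)]
    congr 2
    ring
  simp_rw [e]
  rw [ENNReal.tsum_geometric]
  apply ENNReal.inv_ne_top.2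
  rw [Ne, tsub_eq_zero_iff_le, not_le, ENNReal.ofReal_lt_one]
  exact Real.rpow_lt_one_of_one_lt_of_neg (by norm_num) (by linarith)

/-- Choice of the frequency cut-off. -/
theorem choose_N {δ B : ℝ} (hδ : 0 < δ) (hB : 0 ≤ B) : ∃ N : ℕ, 0 < N ∧
    (2:ℝ) ^ (-((N:ℝ) * δ)) * B ≤ 1 ∧
    (N:ℝ) ≤ (1 / (δ * Real.log 2) + 1) * Real.log (Real.exp 1 + B) := by
  have hl2 : 0 < Real.log 2 := Real.log_pos (by norm_num)
  have hpos : 0 < Real.exp 1 + B := by positivity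
  have hL : 1 ≤ Real.log (Real.exp 1 + B) := by
    rw [Real.le_log_iff_exp_le hpos]; linarith
  set L := Real.log (Real.exp 1 + B) with hLdef
  have hx : 0 < L / (δ * Real.log 2) := by positivity
  refine ⟨⌈L / (δ * Real.log 2)⌉₊, Nat.ceil_pos.2 hx, ?_, ?_⟩
  · have h1 := Nat.le_ceil (L / (δ * Real.log 2))
    set n : ℝ := (⌈L / (δ * Real.log 2)⌉₊ : ℝ)
    rw [div_le_iff₀ (by positivity)] at h1
    rw [Real.rpow_def_of_pos (by norm_num)]
    have h2 : Real.exp (Real.log 2 * (-(n * δ))) ≤ Real.exp (-L) :=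
      Real.exp_le_exp.2 (by nlinarith)
    have h3 : Real.exp (-L) * (Real.exp 1 + B) = 1 := by
      rw [Real.exp_neg, hLdef, Real.exp_log hpos, inv_mul_cancel₀ hpos.ne']
    have h4 : 0 < Real.exp (-L) * Real.exp 1 := by positivity
    nlinarith
  · have h1 := (Nat.ceil_lt_add_one hx.le).le
    calc _ ≤ L / (δ * Real.log 2) + 1 := h1
      _ ≤ _ := by
        rw [add_mul, one_mul, one_div, div_eq_mul_inv, mul_comm L]
        linarith

theorem theta_mem {ρ : ℝ≥0∞} (hρ : 1 ≤ ρ) : 0 ≤ 1 - 1/ρ.toReal ∧ 1 - 1/ρ.toReal ≤ 1 := by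
  constructor
  · by_cases h : ρ = ⊤
    · subst h; simp
    · have hr1 : 1 ≤ ρ.toReal := by
        rw [← ENNReal.toReal_one]
        exact ENNReal.toReal_mono h hρ
      have : 1/ρ.toReal ≤ 1 := by
        rw [div_le_one (by linarith)]; exact hr1
      linarith
  · have : 0 ≤ 1/ρ.toReal := by positivity
    linarith

theorem inhom_low {d : ℕ} {k k₀ : EuclideanSpace ℝ (Fin d) → ℂ} {s : ℝ} {q σ : ℝ≥0∞} (hσ : 1 ≤ σ)
    (u : EuclideanSpace ℝ (Fin d) → ℂ) :
    eLpNorm (lowblock d k₀ u) q volume ≤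
      ENNReal.ofReal ((2:ℝ)^s) * inhomBesov d k k₀ s q σ u := by
  have h := le_lqnorm hσ (fun j => if j < -1 then 0 else
    ENNReal.ofReal ((2:ℝ) ^ ((j:ℝ)*s)) *
      eLpNorm (if j = -1 then lowblock d k₀ u else hblock d k j u) q volume) (-1)
  simp only [lt_irrefl, if_false, if_true] at h
  calc _ = ENNReal.ofReal ((2:ℝ)^s) * (ENNReal.ofReal ((2:ℝ) ^ (((-1:ℤ):ℝ)*s)) *
        eLpNorm (lowblock d k₀ u) q volume) := by
        rw [← mul_assoc, ← ENNReal.ofReal_mul (by positivity), ← Real.rpow_add (by norm_num)]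
        simp
    _ ≤ _ := by
        gcongr
        exact h

theorem inhom_high {d : ℕ} {k k₀ : EuclideanSpace ℝ (Fin d) → ℂ} {s : ℝ} {q σ : ℝ≥0∞} (hσ : 1 ≤ σ)
    (u : EuclideanSpace ℝ (Fin d) → ℂ) (j : ℕ) :
    eLpNorm (hblock d k (j:ℤ) u) q volume ≤
      ENNReal.ofReal ((2:ℝ)^(-((j:ℝ)*s))) * inhomBesov d k k₀ s q σ u := by
  have h := le_lqnorm hσ (fun j => if j < -1 then 0 else
    ENNReal.ofReal ((2:ℝ) ^ ((j:ℝ)*s)) *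
      eLpNorm (if j = -1 then lowblock d k₀ u else hblock d k j u) q volume) (j:ℤ)
  rw [if_neg (by omega), if_neg (by omega)] at h
  calc _ = ENNReal.ofReal ((2:ℝ)^(-((j:ℝ)*s))) * (ENNReal.ofReal ((2:ℝ) ^ (((j:ℤ):ℝ)*s)) *
        eLpNorm (hblock d k (j:ℤ) u) q volume) := by
        rw [← mul_assoc, ← ENNReal.ofReal_mul (by positivity), ← Real.rpow_add (by norm_num)]
        simp
    _ ≤ _ := by
        gcongr
        exact h

theorem enorm_le_blocks {d : ℕ} {k k₀ : EuclideanSpace ℝ (Fin d) → ℂ}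
    {u : EuclideanSpace ℝ (Fin d) → ℂ}
    (hu : ∀ x, u x = lowblock d k₀ u x + ∑' j : ℕ, hblock d k (j:ℤ) u x)
    (x : EuclideanSpace ℝ (Fin d)) :
    ‖u x‖ₑ ≤ ‖lowblock d k₀ u x‖ₑ + ∑' j : ℕ, ‖hblock d k (j:ℤ) u x‖ₑ := by
  conv_lhs => rw [hu x]
  refine (enorm_add_le _ _).trans ?_
  gcongr
  exact enorm_tsum_le_tsum_enorm

theorem u_bound {d : ℕ} {k k₀ : EuclideanSpace ℝ (Fin d) → ℂ}
    (hk_int : Integrable k) (hk₀_int : Integrable k₀) {s : ℝ} {q σ : ℝ≥0∞} (hq1 : 1 ≤ q)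
    (hq2 : q ≠ ⊤) (hσ : 1 ≤ σ) {u : EuclideanSpace ℝ (Fin d) → ℂ}
    (hum : AEStronglyMeasurable u volume)
    (hu : ∀ x, u x = lowblock d k₀ u x + ∑' j : ℕ, hblock d k (j:ℤ) u x) :
    eLpNorm u q volume ≤ (ENNReal.ofReal ((2:ℝ)^s) +
      ∑' i : ℕ, ENNReal.ofReal ((2:ℝ) ^ (-((i:ℝ) * s)))) * inhomBesov d k k₀ s q σ u := by
  let g : ℕ → EuclideanSpace ℝ (Fin d) → ℂ := fun n =>
    match n with
    | 0 => lowblock d k₀ u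
    | n+1 => hblock d k (n:ℤ) u
  have hg : ∀ n, AEStronglyMeasurable (g n) volume := by
    intro n
    cases n with
    | zero => exact lowblock_aesm hk₀_int hum
    | succ n => exact hblock_aesm hk_int hum _
  have h1 := eLpNorm_tsum_bound hq1 hq2 (u := u) hg (fun x => by
    rw [tsum_eq_zero_add' ENNReal.summable]
    exact enorm_le_blocks hu x)
  refine h1.trans ?_
  rw [tsum_eq_zero_add' ENNReal.summable, add_mul, ← ENNReal.tsum_mul_right]
  exact add_le_add (inhom_low hσ u) (ENNReal.tsum_le_tsum fun n => inhom_high hσ u n)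

/-- logarithmic critical Sobolev (Kozono–Ogawa–Taniuchi) inequality:
for `s > d/q`, `‖u‖_{L^∞} ≤ C (1 + ‖u‖_{Ḃ^{d/p}_{p,ρ}} (log(e + ‖u‖_{B^s_{q,σ}}))^{1 − 1/ρ})`,
with `C = C(d,p,q)` independent of `ρ` and `σ`. -/
theorem stmt16 (d : ℕ) (hd : 1 ≤ d)
    (φ : EuclideanSpace ℝ (Fin d) → ℝ) (hφ_smooth : ContDiff ℝ (⊤ : ℕ∞) φ)
    (hφ_range : ∀ ξ, φ ξ ∈ Set.Icc (0:ℝ) 1)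
    (hφ_supp : Function.support φ ⊆
      {ξ : EuclideanSpace ℝ (Fin d) | 3/4 ≤ ‖ξ‖ ∧ ‖ξ‖ ≤ 8/3})
    (hφ_sum : ∀ ξ : EuclideanSpace ℝ (Fin d), ξ ≠ 0 →
      (∑' j : ℤ, φ ((2:ℝ)^(-j) • ξ)) = 1)
    (k k₀ : EuclideanSpace ℝ (Fin d) → ℂ)
    (hk_int : Integrable k) (hk₀_int : Integrable k₀)
    (hk : ∀ ξ, FT d k ξ = ((φ ξ : ℝ) : ℂ))
    (hk₀ : ∀ ξ, FT d k₀ ξ =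
      ((1 - ∑' j : ℕ, φ ((2:ℝ)^(-(j:ℤ)) • ξ) : ℝ) : ℂ))
    (p q : ℝ≥0∞) (hp : 1 ≤ p) (hq1 : 1 ≤ q) (hq2 : q ≠ ⊤)
    (s : ℝ) (hs : (d:ℝ) / q.toReal < s) :
    ∃ C : ℝ, 0 < C ∧ ∀ (ρ σ : ℝ≥0∞), 1 ≤ ρ → 1 ≤ σ →
      ∀ u : EuclideanSpace ℝ (Fin d) → ℂ, Measurable u →
      (∀ x, u x = lowblock d k₀ u x + ∑' j : ℕ, hblock d k (j:ℤ) u x) →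
      homBesov d k ((d:ℝ)/p.toReal) p ρ u ≠ ⊤ →
      inhomBesov d k k₀ s q σ u ≠ ⊤ →
      eLpNorm u ⊤ volume ≤ ENNReal.ofReal (C * (1 +
        (homBesov d k ((d:ℝ)/p.toReal) p ρ u).toReal *
          (Real.log (Real.exp 1 + (inhomBesov d k k₀ s q σ u).toReal))
            ^ (1 - 1/ρ.toReal))) := by
  classical
  obtain ⟨h, hrep⟩ := exists_reproducing d
  have hrk := hrep k hk_int (fun ξ hξ => by
    rw [hk, phi_zero_of_large hφ_supp (by linarith)]; simp)
  have hrk₀ := hrep k₀ hk₀_int (fun ξ hξ => by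
    rw [hk₀, psi_zero_of_large hφ_supp hφ_sum hξ]; simp)
  have hkk := kernel_relation hφ_supp hk_int hk₀_int hk hk₀
  obtain ⟨p', hp'⟩ := exists_conj hp
  obtain ⟨q', hq'⟩ := exists_conj hq1
  have hqpos : 0 < q.toReal := ENNReal.toReal_pos (zero_lt_one.trans_le hq1).ne' hq2
  have hdq : 0 < (d:ℝ) / q.toReal := by
    have : (0:ℝ) < d := by exact_mod_cast hd
    positivity
  set δ : ℝ := min ((d:ℝ) / q.toReal) (s - (d:ℝ) / q.toReal) with hδdef
  have hδ : 0 < δ := lt_min hdq (by linarith)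
  have hs0 : 0 < s := hdq.trans hs
  set K1 : ℝ≥0∞ := ENNReal.ofReal ((2:ℝ)^s) + ∑' i : ℕ, ENNReal.ofReal ((2:ℝ) ^ (-((i:ℝ) * s)))
    with hK1
  have hK1t : K1 ≠ ⊤ := ENNReal.add_ne_top.2 ⟨ENNReal.ofReal_ne_top, geom_ne_top hs0⟩
  set K2 : ℝ≥0∞ := ∑' i : ℕ, ENNReal.ofReal ((2:ℝ) ^ (-((i:ℝ) * (s - (d:ℝ) / q.toReal)))) with hK2
  have hK2t : K2 ≠ ⊤ := geom_ne_top (by linarith)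
  set Hq : ℝ≥0∞ := eLpNorm h q' volume with hHq
  have hHqt : Hq ≠ ⊤ := (h.memLp q' volume).2.ne
  set Hp : ℝ≥0∞ := eLpNorm h p' volume with hHp
  have hHpt : Hp ≠ ⊤ := (h.memLp p' volume).2.ne
  set A : ℝ≥0∞ := eLpNorm k₀ 1 volume with hA
  have hAt : A ≠ ⊤ := (memLp_one_iff_integrable.2 hk₀_int).2.ne
  set M0 : ℝ≥0∞ := A * (Hq * K1) + Hq * K2 with hM0
  have hM0t : M0 ≠ ⊤ := by
    rw [hM0]; finiteness
  set K : ℝ := 1 / (δ * Real.log 2) + 1 with hK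
  have hl2 : 0 < Real.log 2 := Real.log_pos (by norm_num)
  have hK1le : 1 ≤ K := by
    have : 0 < 1 / (δ * Real.log 2) := by positivity
    linarith
  refine ⟨M0.toReal + 2 * Hp.toReal * K + 1, by positivity, ?_⟩
  intro ρ σ hρ hσ u hum hu hH hB
  have hub := u_bound (s := s) hk_int hk₀_int hq1 hq2 hσ hum.aestronglyMeasurable hu
  rw [← hK1] at hub
  set Bn := inhomBesov d k k₀ s q σ u with hBn
  set Hn := homBesov d k ((d:ℝ)/p.toReal) p ρ u with hHn
  have huL : MemLp u q volume :=
    ⟨hum.aestronglyMeasurable, hub.trans_lt (ENNReal.mul_lt_top hK1t.lt_top hB.lt_top)⟩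
  obtain ⟨N, hN0, hN1, hN2⟩ := choose_N (B := Bn.toReal) hδ ENNReal.toReal_nonneg
  rw [← hK] at hN2
  set L := Real.log (Real.exp 1 + Bn.toReal) with hL
  set θ := 1 - 1/ρ.toReal with hθ
  obtain ⟨hθ0, hθ1⟩ := theta_mem hρ
  rw [← hθ] at hθ0 hθ1
  have hLpos : 1 ≤ L := by
    rw [hL, Real.le_log_iff_exp_le (by positivity)]
    linarith [ENNReal.toReal_nonneg (a := Bn)]
  -- small factor
  have hsmall : ∀ ε : ℝ, δ ≤ ε → ENNReal.ofReal ((2:ℝ) ^ (-((N:ℝ) * ε))) * Bn ≤ 1 := by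
    intro ε hε
    rw [← ENNReal.ofReal_toReal hB, ← ENNReal.ofReal_mul (by positivity)]
    rw [ENNReal.ofReal_le_one]
    refine le_trans ?_ hN1
    have : (2:ℝ) ^ (-((N:ℝ) * ε)) ≤ (2:ℝ) ^ (-((N:ℝ) * δ)) :=
      Real.rpow_le_rpow_of_exponent_le (by norm_num)
        (neg_le_neg (mul_le_mul_of_nonneg_left hε (Nat.cast_nonneg N)))
    exact mul_le_mul_of_nonneg_right this ENNReal.toReal_nonneg
  -- the count
  have hNθ : (N:ℝ) ^ θ ≤ K * L ^ θ := by
    calc (N:ℝ) ^ θ ≤ (K * L) ^ θ := Real.rpow_le_rpow (by positivity) hN2 hθ0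
      _ = K ^ θ * L ^ θ := Real.mul_rpow (by linarith) (by linarith)
      _ ≤ K * L ^ θ := by
        gcongr
        calc K ^ θ ≤ K ^ (1:ℝ) := Real.rpow_le_rpow_of_exponent_le hK1le hθ1
          _ = K := Real.rpow_one K
  have hmid : ∀ g : ℕ → ℤ, Function.Injective g → ∀ x,
      ∑ i ∈ Finset.range N, ‖hblock d k (g i) u x‖ₑ ≤ Hp * (ENNReal.ofReal (K * L ^ θ) * Hn) := by
    intro g hg x
    calc ∑ i ∈ Finset.range N, ‖hblock d k (g i) u x‖ₑ
        ≤ ∑ i ∈ Finset.range N, Hp *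
          (ENNReal.ofReal ((2:ℝ) ^ (((g i : ℤ):ℝ)*((d:ℝ)/p.toReal))) *
            eLpNorm (hblock d k (g i) u) p volume) :=
          Finset.sum_le_sum fun i _ => hblock_bound2 (p := p) (p' := p') h hq1 hk_int hrk huL (g i) x
      _ ≤ Hp * (ENNReal.ofReal ((N:ℝ) ^ θ) * Hn) := by
          rw [← Finset.mul_sum]
          gcongr
          exact sum_le_lqnorm hρ _ N hN0 g hg
      _ ≤ _ := by gcongr
  have hlow : ∀ x, ‖hblock d k₀ (-(N:ℤ)) u x‖ₑ ≤ A * (Hq * K1) := by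
    intro x
    refine (hblock_bound1 (r := q) (r' := q') h hk₀_int hrk₀ huL (-(N:ℤ)) x).trans ?_
    gcongr
    calc _ ≤ ENNReal.ofReal ((2:ℝ) ^ (((-(N:ℤ) : ℤ):ℝ) * ((d:ℝ)/q.toReal))) * (K1 * Bn) := by gcongr
      _ = K1 * (ENNReal.ofReal ((2:ℝ) ^ (-((N:ℝ) * ((d:ℝ)/q.toReal)))) * Bn) := by
        push_cast
        rw [neg_mul]
        ring
      _ ≤ K1 * 1 := by
        gcongr
        exact hsmall _ (min_le_left _ _)
      _ = K1 := mul_one _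
  have hhigh : ∀ x, ∑' i : ℕ, ‖hblock d k ((i + N : ℕ) : ℤ) u x‖ₑ ≤ Hq * K2 := by
    intro x
    have hterm : ∀ i : ℕ, ‖hblock d k ((i + N : ℕ) : ℤ) u x‖ₑ ≤
        Hq * ENNReal.ofReal ((2:ℝ) ^ (-((i:ℝ) * (s - (d:ℝ) / q.toReal)))) := by
      intro i
      refine (hblock_bound2 (p := q) (p' := q') h hq1 hk_int hrk huL _ x).trans ?_
      gcongr
      calc _ ≤ ENNReal.ofReal ((2:ℝ) ^ ((((i+N:ℕ):ℤ):ℝ) * ((d:ℝ)/q.toReal))) *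
            (ENNReal.ofReal ((2:ℝ)^(-(((i+N:ℕ):ℝ)*s))) * Bn) := by
            gcongr
            exact inhom_high hσ u (i+N)
        _ = ENNReal.ofReal ((2:ℝ) ^ (-((i:ℝ) * (s - (d:ℝ) / q.toReal)))) *
            (ENNReal.ofReal ((2:ℝ) ^ (-((N:ℝ) * (s - (d:ℝ) / q.toReal)))) * Bn) := by
            rw [← mul_assoc, ← mul_assoc, ← ENNReal.ofReal_mul (by positivity),
              ← ENNReal.ofReal_mul (by positivity), ← Real.rpow_add (by norm_num),
              ← Real.rpow_add (by norm_num)]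
            congr 3
            push_cast
            ring
        _ ≤ ENNReal.ofReal ((2:ℝ) ^ (-((i:ℝ) * (s - (d:ℝ) / q.toReal)))) * 1 := by
            gcongr
            exact hsmall _ (min_le_right _ _)
        _ = _ := mul_one _
    refine (ENNReal.tsum_le_tsum hterm).trans ?_
    rw [ENNReal.tsum_mul_left]
  have hpt : ∀ x, ‖u x‖ₑ ≤ M0 + 2 * (Hp * (ENNReal.ofReal (K * L ^ θ) * Hn)) := by
    intro x
    have h1 := enorm_le_blocks hu x
    rw [hblock_telescope_sum h hq1 hk₀_int hrk₀ hkk huL N x,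
      ← (ENNReal.summable (f := fun i : ℕ => ‖hblock d k ((i + N : ℕ):ℤ) u x‖ₑ)).sum_add_tsum_nat_add'
        (f := fun j : ℕ => ‖hblock d k (j:ℤ) u x‖ₑ)] at h1
    have h2 : ‖hblock d k₀ (-(N:ℤ)) u x + ∑ i ∈ Finset.range N, hblock d k (-(i:ℤ) - 1) u x‖ₑ ≤
        A * (Hq * K1) + Hp * (ENNReal.ofReal (K * L ^ θ) * Hn) := by
      refine (enorm_add_le _ _).trans (add_le_add (hlow x) ?_)
      refine (enorm_sum_le _ _).trans (hmid (fun i => -(i:ℤ) - 1) (fun a b hab => ?_) x)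
      simpa using hab
    have h3 := hmid (fun i => (i:ℤ)) Nat.cast_injective x
    refine h1.trans ((add_le_add h2 (add_le_add h3 (hhigh x))).trans (le_of_eq ?_))
    rw [hM0]
    ring
  have hK0 : 0 ≤ K := by linarith
  have hLθ : 0 ≤ L ^ θ := Real.rpow_nonneg (by linarith) θ
  have hT : 0 ≤ K * L ^ θ := mul_nonneg hK0 hLθ
  have hfin : M0 + 2 * (Hp * (ENNReal.ofReal (K * L ^ θ) * Hn)) =
      ENNReal.ofReal (M0.toReal + 2 * (Hp.toReal * (K * L ^ θ * Hn.toReal))) := by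
    clear hpt
    generalize K * L ^ θ = T at hT ⊢
    rw [ENNReal.ofReal_add ENNReal.toReal_nonneg (by positivity), ENNReal.ofReal_mul (by norm_num),
      ENNReal.ofReal_mul (by positivity), ENNReal.ofReal_mul hT,
      ENNReal.ofReal_toReal hM0t, ENNReal.ofReal_toReal hHpt, ENNReal.ofReal_toReal hH]
    simp
  rw [eLpNorm_exponent_top]
  refine (eLpNormEssSup_le_of_ae_enorm_bound (Filter.Eventually.of_forall hpt)).trans ?_
  rw [hfin]
  apply ENNReal.ofReal_le_ofReal
  have e1 : 0 ≤ Hn.toReal * L ^ θ := by positivity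
  have e2 : 0 ≤ M0.toReal := ENNReal.toReal_nonneg
  have e3 : 0 ≤ Hp.toReal * K := by positivity
  nlinarith [mul_nonneg e2 e1]

end
end
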